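/- arXiv:2403.12681 — 2 statements merged into one kernel-verified Lean document; each statement's English description precedes it below -/
import Mathlib

section
/- Let a, b, c be pairwise relatively prime positive integers and let R = k[x,y,z] = k^[3] be endowed with the ℕ-grading in which x, y, z are homogeneous of degrees a, b, c. Let s be a nonzero homogeneous element of R such that δ(s) ≠ 0 for every nonzero locally nilpotent derivation δ of R. Assume D is an irreducible homogeneous locally nilpotent derivation of R with D²(s) = 0, and write ker D = k[u,v] with u, v homogeneous. Then: (a) Ds ∉ k[u] and Ds ∉ k[v]; (b) if deg(s) ≠ a + b + c, then min(deg u, deg v) ≤ max{2, deg(s) − (a+b+c)}. -/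
open MvPolynomial

set_option synthInstance.maxHeartbeats 400000
set_option maxHeartbeats 1000000

noncomputable section

/-- `D` is a locally nilpotent derivation: every element is killed by some power of `D`. -/
def IsLND {k B : Type*} [CommRing k] [CommRing B] [Algebra k B]
    (D : Derivation k B B) : Prop :=
  ∀ b : B, ∃ n : ℕ, (⇑D)^[n] b = 0

/-- A derivation `D` is irreducible if the only principal ideal of `B` containing the
image of `D` is `B` itself. -/
def IsIrreducibleDeriv {k B : Type*} [CommRing k] [CommRing B] [Algebra k B]
    (D : Derivation k B B) : Prop :=
  ∀ b : B, (∀ r : B, D r ∈ Ideal.span {b}) → IsUnit b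

/-- `D` is a homogeneous derivation of degree `m` with respect to the `ℕ`-grading of
`k[x,y,z]` in which the variables have weights `w`, i.e. `D(R_i) ⊆ R_{i+m}` for all `i`. -/
def DerivIsHomogOfDeg {k : Type} [Field k] (w : Fin 3 → ℕ)
    (D : Derivation k (MvPolynomial (Fin 3) k) (MvPolynomial (Fin 3) k)) (m : ℤ) : Prop :=
  ∀ (i : ℕ) (f : MvPolynomial (Fin 3) k), f.IsWeightedHomogeneous w i →
    (∀ j : ℕ, (j : ℤ) = (i : ℤ) + m → (D f).IsWeightedHomogeneous w j) ∧
    ((i : ℤ) + m < 0 → D f = 0)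


set_option linter.all false
set_option linter.unusedSectionVars false

section general
variable {k R : Type*} [Field k] [CharZero k] [CommRing R] [IsDomain R] [Algebra k R]

theorem der_iter_zero (D : Derivation k R R) (n : ℕ) : (⇑D)^[n] 0 = 0 := by
  induction n with
  | zero => rfl
  | succ n ih => rw [Function.iterate_succ_apply, map_zero, ih]

theorem der_iter_add (D : Derivation k R R) (n : ℕ) (x y : R) :
    (⇑D)^[n] (x + y) = (⇑D)^[n] x + (⇑D)^[n] y := by
  induction n generalizing x y with
  | zero => rfl
  | succ n ih => simp only [Function.iterate_succ_apply, map_add, ih]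

theorem der_iter_mul (D : Derivation k R R) (n : ℕ) (x y : R) (hx : D x = 0) :
    (⇑D)^[n] (x * y) = x * (⇑D)^[n] y := by
  induction n generalizing y with
  | zero => rfl
  | succ n ih =>
    simp only [Function.iterate_succ_apply]
    rw [D.leibniz, hx, smul_zero, add_zero, smul_eq_mul, ih]

theorem der_iter_le (D : Derivation k R R) {m n : ℕ} (h : m ≤ n) {x : R}
    (hx : (⇑D)^[m] x = 0) : (⇑D)^[n] x = 0 := by
  obtain ⟨t, rfl⟩ := Nat.exists_eq_add_of_le h
  rw [add_comm, Function.iterate_add_apply, hx, der_iter_zero]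

theorem der_leib (D : Derivation k R R) (m : ℕ) : ∀ (n : ℕ) (x y : R),
    (⇑D)^[m+1] x = 0 → (⇑D)^[n+1] y = 0 →
    ∃ C : ℕ, 0 < C ∧ (⇑D)^[m+n] (x*y) = (C : R) * ((⇑D)^[m] x * (⇑D)^[n] y) := by
  induction m with
  | zero =>
    intro n x y hx _
    refine ⟨1, one_pos, ?_⟩
    have hx' : D x = 0 := hx
    rw [zero_add, der_iter_mul D n x y hx']
    simp
  | succ m ihm =>
    intro n
    induction n with
    | zero =>
      intro x y hx hy
      refine ⟨1, one_pos, ?_⟩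
      have hy' : D y = 0 := hy
      rw [add_zero, mul_comm, der_iter_mul D _ y x hy']
      simp [mul_comm]
    | succ n ihn =>
      intro x y hx hy
      obtain ⟨C1, h1, e1⟩ := ihm (n+1) (D x) y (by simpa [Function.iterate_succ_apply] using hx) hy
      obtain ⟨C2, h2, e2⟩ := ihn x (D y) hx (by simpa [Function.iterate_succ_apply] using hy)
      refine ⟨C1 + C2, by omega, ?_⟩
      have : m + 1 + (n + 1) = (m + (n+1)) + 1 := by omega
      rw [this, Function.iterate_succ_apply, D.leibniz, der_iter_add, smul_eq_mul, smul_eq_mul,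
        mul_comm y, e1]
      have h3 : m + (n+1) = m + 1 + n := by omega
      rw [h3, e2]
      simp only [Function.iterate_succ_apply]
      push_cast
      ring

theorem der_nil_mul (D : Derivation k R R) {x y : R} (hx : ∃ n, (⇑D)^[n] x = 0)
    (hy : ∃ n, (⇑D)^[n] y = 0) : ∃ n, (⇑D)^[n] (x * y) = 0 := by
  obtain ⟨m, hm⟩ := hx
  obtain ⟨n, hn⟩ := hy
  obtain ⟨C, -, e⟩ := der_leib D m n x y (der_iter_le D (Nat.le_succ m) hm)
    (der_iter_le D (Nat.le_succ n) hn)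
  exact ⟨m + n, by rw [e, hm]; simp⟩

theorem der_nil_adjoin (D : Derivation k R R) (S : Set R) (hS : ∀ x ∈ S, ∃ n, (⇑D)^[n] x = 0)
    {x : R} (hx : x ∈ Algebra.adjoin k S) : ∃ n, (⇑D)^[n] x = 0 := by
  induction hx using Algebra.adjoin_induction with
  | mem x h => exact hS x h
  | algebraMap r => exact ⟨1, by simp⟩
  | add x y _ _ hx hy =>
    obtain ⟨m, hm⟩ := hx
    obtain ⟨n, hn⟩ := hy
    refine ⟨max m n, ?_⟩
    rw [der_iter_add, der_iter_le D (le_max_left m n) hm, der_iter_le D (le_max_right m n) hn,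
      add_zero]
  | mul x y _ _ hx hy => exact der_nil_mul D hx hy

theorem exists_top (D : Derivation k R R) (hD : IsLND D) {x : R} (hx : x ≠ 0) :
    ∃ m, (⇑D)^[m] x ≠ 0 ∧ (⇑D)^[m+1] x = 0 := by
  classical
  have h := hD x
  have h0 : Nat.find h ≠ 0 := by
    intro h0
    have := Nat.find_spec h
    rw [h0] at this
    exact hx this
  obtain ⟨m, hm⟩ := Nat.exists_eq_succ_of_ne_zero h0
  refine ⟨m, Nat.find_min h (by omega), ?_⟩
  have := Nat.find_spec h
  rwa [hm] at this

theorem fact_closed (D : Derivation k R R) (hD : IsLND D) {x y : R} (h0 : x * y ≠ 0)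
    (h : D (x * y) = 0) : D x = 0 := by
  have : CharZero R := charZero_of_injective_algebraMap (algebraMap k R).injective
  obtain ⟨m, hm, hm'⟩ := exists_top D hD (left_ne_zero_of_mul h0)
  obtain ⟨n, hn, hn'⟩ := exists_top D hD (right_ne_zero_of_mul h0)
  obtain ⟨C, hC, e⟩ := der_leib D m n x y hm' hn'
  rcases Nat.eq_zero_or_pos m with rfl | hpos
  · exact hm'
  · exfalso
    have : (⇑D)^[m+n] (x*y) = 0 := der_iter_le D (m := 1) (by omega) h
    rw [this] at e
    have : (C : R) ≠ 0 := by exact_mod_cast hC.ne'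
    exact mul_ne_zero this (mul_ne_zero hm hn) e.symm

theorem fact_closed_dvd (D : Derivation k R R) (hD : IsLND D) {x z : R} (h0 : z ≠ 0)
    (h : D z = 0) (hd : x ∣ z) : D x = 0 := by
  obtain ⟨y, rfl⟩ := hd
  exact fact_closed D hD h0 h

theorem slice_thm (D : Derivation k R R) (s : R) (hs : D (D s) = 0) (n : ℕ) :
    ∀ r : R, (⇑D)^[n] r = 0 → ∃ (N M : ℕ) (a : ℕ → R), (∀ i, D (a i) = 0) ∧
      (D s)^N * r = ∑ i ∈ Finset.range M, a i * s^i := by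
  induction n with
  | zero =>
    intro r hr
    have : r = 0 := hr
    exact ⟨0, 0, fun _ => 0, by simp, by simp [this]⟩
  | succ n ih =>
    intro r hr
    rw [Function.iterate_succ_apply] at hr
    obtain ⟨N, M, a, ha, e⟩ := ih (D r) hr
    let g : R := ∑ i ∈ Finset.range M, ((1 / ((i:k) + 1)) • a i) * s^(i+1)
    have hpow : ∀ j, D ((D s)^j) = 0 := by
      intro j; rw [D.leibniz_pow, hs]; simp
    have hg : D g = (D s)^(N+1) * D r := by
      rw [pow_succ, mul_right_comm, e, Finset.sum_mul, map_sum]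
      apply Finset.sum_congr rfl
      intro i _
      have hi : ((i:k)+1) ≠ 0 := by exact_mod_cast Nat.succ_ne_zero i
      rw [D.leibniz, D.map_smul, ha, smul_zero, smul_zero, add_zero, D.leibniz_pow]
      simp only [smul_eq_mul, nsmul_eq_mul, Nat.add_sub_cancel]
      rw [Algebra.smul_def]
      have : (((i+1 : ℕ)) : R) = algebraMap k R ((i:k)+1) := by simp
      rw [this]
      have h2 : algebraMap k R (1/((i:k)+1)) * algebraMap k R ((i:k)+1) = 1 := by
        rw [← map_mul, one_div, inv_mul_cancel₀ hi, map_one]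
      linear_combination (a i * s^i * D s) * h2
    refine ⟨N+1, M+1, fun i => Nat.casesOn i ((D s)^(N+1) * r - g)
      (fun i => (1 / ((i:k) + 1)) • a i), ?_, ?_⟩
    · intro i
      cases i with
      | zero =>
        change D ((D s)^(N+1) * r - g) = 0
        rw [map_sub, hg, D.leibniz, hpow, smul_eq_mul, smul_eq_mul]
        ring
      | succ i => simp [ha]
    · rw [Finset.sum_range_succ']
      simp only [pow_zero, mul_one]
      change _ = g + ((D s)^(N+1) * r - g)
      ring

theorem adjoin_pair_deriv (u v : R) {p : R} (hp : p ∈ Algebra.adjoin k ({u, v} : Set R)) :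
    ∃ g₁ g₂ : R, ∀ d : Derivation k R R, d p = g₁ * d u + g₂ * d v := by
  induction hp using Algebra.adjoin_induction with
  | mem x h =>
    rcases h with rfl | h
    · exact ⟨1, 0, by simp⟩
    · rw [Set.mem_singleton_iff.1 h]
      exact ⟨0, 1, by simp⟩
  | algebraMap r => exact ⟨0, 0, by simp⟩
  | add x y _ _ hx hy =>
    obtain ⟨a, b, h⟩ := hx
    obtain ⟨a', b', h'⟩ := hy
    exact ⟨a + a', b + b', fun d => by rw [map_add, h, h']; ring⟩
  | mul x y _ _ hx hy =>
    obtain ⟨a, b, h⟩ := hx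
    obtain ⟨a', b', h'⟩ := hy
    exact ⟨x * a' + y * a, x * b' + y * b, fun d => by
      rw [d.leibniz, h, h', smul_eq_mul, smul_eq_mul]; ring⟩

theorem adjoin_triple_deriv (u v s : R) {p : R}
    (hp : p ∈ Algebra.adjoin k ({u, v, s} : Set R)) :
    ∃ g₁ g₂ g₃ : R, ∀ d : Derivation k R R, d p = g₁ * d u + g₂ * d v + g₃ * d s := by
  induction hp using Algebra.adjoin_induction with
  | mem x h =>
    rcases h with rfl | rfl | h
    · exact ⟨1, 0, 0, by simp⟩
    · exact ⟨0, 1, 0, by simp⟩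
    · rw [Set.mem_singleton_iff.1 h]
      exact ⟨0, 0, 1, by simp⟩
  | algebraMap r => exact ⟨0, 0, 0, by simp⟩
  | add x y _ _ hx hy =>
    obtain ⟨a, b, c, h⟩ := hx
    obtain ⟨a', b', c', h'⟩ := hy
    exact ⟨a + a', b + b', c + c', fun d => by rw [map_add, h, h']; ring⟩
  | mul x y _ _ hx hy =>
    obtain ⟨a, b, c, h⟩ := hx
    obtain ⟨a', b', c', h'⟩ := hy
    exact ⟨x * a' + y * a, x * b' + y * b, x * c' + y * c, fun d => by
      rw [d.leibniz, h, h', smul_eq_mul, smul_eq_mul]; ring⟩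

theorem slice_adjoin (D : Derivation k R R) (hD : IsLND D) (s : R) (hs : D (D s) = 0) (u v : R)
    (hker : ∀ r : R, D r = 0 ↔ r ∈ Algebra.adjoin k ({u, v} : Set R)) (r : R) :
    ∃ N : ℕ, (D s)^N * r ∈ Algebra.adjoin k ({u, v, s} : Set R) := by
  obtain ⟨n, hn⟩ := hD r
  obtain ⟨N, M, a, ha, e⟩ := slice_thm D s hs n r hn
  refine ⟨N, e ▸ Subalgebra.sum_mem _ fun i _ => Subalgebra.mul_mem _ ?_ ?_⟩
  · exact Algebra.adjoin_mono (by intro x; simp; tauto) ((hker _).1 (ha i))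
  · exact Subalgebra.pow_mem _ (Algebra.subset_adjoin (by simp)) _

theorem slice_mod (D : Derivation k R R) (hD : IsLND D) (s : R) (hs : D (D s) = 0) (r : R) :
    ∃ (N : ℕ) (α : R), D α = 0 ∧ s ∣ (D s)^N * r - α := by
  obtain ⟨n, hn⟩ := hD r
  obtain ⟨N, M, a, ha, e⟩ := slice_thm D s hs n r hn
  cases M with
  | zero => exact ⟨N, 0, by simp, by simp [e]⟩
  | succ M =>
    refine ⟨N, a 0, ha 0, ?_⟩
    rw [e, Finset.sum_range_succ']
    simp only [pow_zero, mul_one, add_sub_cancel_right]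
    exact Finset.dvd_sum fun i _ => Dvd.intro_left (a (i+1) * s^i) (by ring)

end general

section three
variable {k : Type} [Field k] [CharZero k]


def jacD (p q : MvPolynomial (Fin 3) k) :
    Derivation k (MvPolynomial (Fin 3) k) (MvPolynomial (Fin 3) k) :=
  (pderiv 1 p * pderiv 2 q - pderiv 2 p * pderiv 1 q) • pderiv 0 +
  (pderiv 2 p * pderiv 0 q - pderiv 0 p * pderiv 2 q) • pderiv 1 +
  (pderiv 0 p * pderiv 1 q - pderiv 1 p * pderiv 0 q) • pderiv 2

theorem jacD_apply (p q r : MvPolynomial (Fin 3) k) : jacD p q r =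
    (pderiv 1 p * pderiv 2 q - pderiv 2 p * pderiv 1 q) * pderiv 0 r +
  (pderiv 2 p * pderiv 0 q - pderiv 0 p * pderiv 2 q) * pderiv 1 r +
  (pderiv 0 p * pderiv 1 q - pderiv 1 p * pderiv 0 q) * pderiv 2 r := by
  simp [jacD]

theorem jacD_left (p q : MvPolynomial (Fin 3) k) : jacD p q p = 0 := by
  rw [jacD_apply]; ring

theorem jacD_right (p q : MvPolynomial (Fin 3) k) : jacD p q q = 0 := by
  rw [jacD_apply]; ring

theorem jacD_swap (p q r : MvPolynomial (Fin 3) k) : jacD p r q = - jacD p q r := by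
  rw [jacD_apply, jacD_apply]; ring

structure Cfg (D : Derivation k (MvPolynomial (Fin 3) k) (MvPolynomial (Fin 3) k))
    (s u v : MvPolynomial (Fin 3) k) : Prop where
  lnd : IsLND D
  d2 : D (D s) = 0
  ne : D s ≠ 0
  ker : ∀ r : MvPolynomial (Fin 3) k,
      D r = 0 ↔ r ∈ Algebra.adjoin k ({u, v} : Set (MvPolynomial (Fin 3) k))

variable {D : Derivation k (MvPolynomial (Fin 3) k) (MvPolynomial (Fin 3) k)}
    {s u v : MvPolynomial (Fin 3) k}

theorem Cfg.swap (h : Cfg D s u v) : Cfg D s v u :=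
  ⟨h.lnd, h.d2, h.ne, fun r => by rw [h.ker, Set.pair_comm]⟩

theorem Cfg.Du (h : Cfg D s u v) : D u = 0 := (h.ker u).2 (Algebra.subset_adjoin (by simp))
theorem Cfg.Dv (h : Cfg D s u v) : D v = 0 := (h.ker v).2 (Algebra.subset_adjoin (by simp))

theorem Cfg.dpow (h : Cfg D s u v) (N : ℕ) : D ((D s)^N) = 0 := by
  rw [D.leibniz_pow, h.d2]; simp

theorem Cfg.jac_dvd (h : Cfg D s u v) : ∃ M : ℕ, jacD u v s ∣ (D s)^M := by
  have key : ∀ i : Fin 3, ∃ (N : ℕ) (a : Fin 3 → MvPolynomial (Fin 3) k),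
      ∀ d : Derivation k (MvPolynomial (Fin 3) k) (MvPolynomial (Fin 3) k),
        a 0 * d u + a 1 * d v + a 2 * d s = (D s)^N * d (X i) := by
    intro i
    obtain ⟨N, hN⟩ := slice_adjoin D h.lnd s h.d2 u v h.ker (X i)
    obtain ⟨c1, c2, c3, hc⟩ := adjoin_triple_deriv u v s hN
    obtain ⟨g1, g2, hg⟩ := adjoin_pair_deriv u v ((h.ker _).1 (h.dpow N))
    refine ⟨N, ![c1 - X i * g1, c2 - X i * g2, c3], fun d => ?_⟩
    have h1 := hc d
    have h2 := hg d
    rw [d.leibniz, smul_eq_mul, smul_eq_mul] at h1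
    simp only [Matrix.cons_val_zero, Matrix.cons_val_one, Matrix.cons_val]
    linear_combination (-1 : MvPolynomial (Fin 3) k) * h1 + X i * h2
  choose N a ha using key
  let A : Matrix (Fin 3) (Fin 3) (MvPolynomial (Fin 3) k) := Matrix.of a
  let J : Matrix (Fin 3) (Fin 3) (MvPolynomial (Fin 3) k) :=
    Matrix.of fun i j => pderiv j (![u, v, s] i)
  have hAJ : A * J = Matrix.diagonal fun i => (D s)^(N i) := by
    ext1 i j
    rw [Matrix.mul_apply, Fin.sum_univ_three]
    have := ha i (pderiv j)
    simp only [A, J, Matrix.of_apply, Matrix.cons_val_zero, Matrix.cons_val_one, Matrix.cons_val]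
    rw [this, pderiv_X, Matrix.diagonal_apply]
    by_cases hij : i = j
    · subst hij; simp
    · simp [hij, Pi.single_apply, Ne.symm hij]
  have hdet := congrArg Matrix.det hAJ
  rw [Matrix.det_mul, Matrix.det_diagonal, Finset.prod_pow_eq_pow_sum] at hdet
  refine ⟨_, Dvd.intro_left A.det (Eq.trans ?_ hdet)⟩
  congr 1
  rw [jacD_apply, Matrix.det_fin_three]
  simp only [J, Matrix.of_apply, Matrix.cons_val_zero, Matrix.cons_val_one, Matrix.cons_val]
  ring

theorem Cfg.jac_ne (h : Cfg D s u v) : jacD u v s ≠ 0 := by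
  obtain ⟨M, hM⟩ := h.jac_dvd
  exact ne_zero_of_dvd_ne_zero (pow_ne_zero _ h.ne) hM

theorem Cfg.jac_ker (h : Cfg D s u v) : D (jacD u v s) = 0 := by
  obtain ⟨M, hM⟩ := h.jac_dvd
  exact fact_closed_dvd D h.lnd (pow_ne_zero _ h.ne) (h.dpow M) hM

theorem Cfg.eq_zero_of (h : Cfg D s u v)
    (d : Derivation k (MvPolynomial (Fin 3) k) (MvPolynomial (Fin 3) k))
    (hu : d u = 0) (hv : d v = 0) (hs : d s = 0) (r : MvPolynomial (Fin 3) k) : d r = 0 := by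
  obtain ⟨N, hN⟩ := slice_adjoin D h.lnd s h.d2 u v h.ker r
  obtain ⟨c1, c2, c3, hc⟩ := adjoin_triple_deriv u v s hN
  obtain ⟨g1, g2, hg⟩ := adjoin_pair_deriv u v ((h.ker _).1 (h.dpow N))
  have h1 := hc d
  have h2 := hg d
  rw [d.leibniz, h2, hu, hv, hs] at h1
  simp only [smul_eq_mul, mul_zero, add_zero] at h1
  exact (mul_eq_zero.1 h1).resolve_left (pow_ne_zero _ h.ne)

theorem Cfg.jac_eq (h : Cfg D s u v) (r : MvPolynomial (Fin 3) k) :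
    D s * jacD u v r = jacD u v s * D r := by
  have := h.eq_zero_of (D s • jacD u v - jacD u v s • D) (by simp [jacD_left, h.Du])
    (by simp [jacD_right, h.Dv]) (by simp [mul_comm]) r
  simpa [sub_eq_zero] using this

theorem Cfg.exists_h (h : Cfg D s u v) (hirr : IsIrreducibleDeriv D) :
    ∃ g : MvPolynomial (Fin 3) k, ∀ r, jacD u v r = g * D r := by
  obtain ⟨f', J', c, hrel, hf, hJ⟩ :=
    UniqueFactorizationMonoid.exists_reduced_factors (D s) h.ne (jacD u v s)
  have hc : c ≠ 0 := by
    rintro rfl; exact h.ne (by rw [← hf, zero_mul])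
  have e : ∀ r, f' * jacD u v r = J' * D r := by
    intro r
    apply mul_left_cancel₀ hc
    rw [← mul_assoc, ← mul_assoc, hf, hJ, h.jac_eq]
  have hu : IsUnit f' := hirr f' fun r => Ideal.mem_span_singleton.2
    (hrel.dvd_of_dvd_mul_left (Dvd.intro _ (e r)))
  obtain ⟨w, rfl⟩ := hu
  refine ⟨(↑w⁻¹) * J', fun r => ?_⟩
  rw [mul_assoc, ← e r, Units.inv_mul_cancel_left]

theorem pderiv_zero_const {σ : Type} (P : MvPolynomial σ k) (hP : ∀ i, pderiv i P = 0) :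
    P = C (coeff 0 P) := by
  classical
  ext m
  rw [coeff_C]
  split_ifs with hm
  · rw [← hm]
  · have : ∃ i, m i ≠ 0 := by
      by_contra hcon
      push Not at hcon
      exact hm (Finsupp.ext fun i => (hcon i).symm)
    obtain ⟨i, hi⟩ := this
    have h1 := coeff_pderiv (i := i) P (m - Finsupp.single i 1)
    have h2 : m - Finsupp.single i 1 + Finsupp.single i 1 = m := by
      apply tsub_add_cancel_of_le
      simpa using Nat.one_le_iff_ne_zero.2 hi
    rw [hP, h2, coeff_zero] at h1
    have h3 : (((m - Finsupp.single i 1 : σ →₀ ℕ) i : ℕ) : k) + 1 ≠ 0 := by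
      exact Nat.cast_add_one_ne_zero _
    exact (mul_eq_zero.1 h1.symm).resolve_right h3

theorem totalDegree_pderiv_lt {σ : Type} (P : MvPolynomial σ k) (i : σ) (h : pderiv i P ≠ 0) :
    (pderiv i P).totalDegree < P.totalDegree := by
  classical
  have hP : P.totalDegree ≠ 0 := by
    intro h0
    rw [totalDegree_eq_zero_iff_eq_C] at h0
    rw [h0, pderiv_C] at h
    exact h rfl
  rw [totalDegree, Finset.sup_lt_iff (by simpa using Nat.pos_of_ne_zero hP)]
  intro m hm
  rw [mem_support_iff, coeff_pderiv] at hm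
  have h1 : m + Finsupp.single i 1 ∈ P.support := mem_support_iff.2 (left_ne_zero_of_mul hm)
  have h2 := le_totalDegree h1
  rw [Finsupp.sum_add_index' (by simp) (by simp), Finsupp.sum_single_index rfl] at h2
  omega

theorem Cfg.algInd (h : Cfg D s u v) : AlgebraicIndependent k ![u, v] := by
  rw [algebraicIndependent_iff]
  have key : ∀ n : ℕ, ∀ P : MvPolynomial (Fin 2) k, P.totalDegree ≤ n →
      aeval ![u, v] P = 0 → P = 0 := by
    have chain : ∀ (d : Derivation k (MvPolynomial (Fin 3) k) (MvPolynomial (Fin 3) k))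
        (P : MvPolynomial (Fin 2) k), d (aeval ![u, v] P) =
        aeval ![u, v] (pderiv 0 P) * d u + aeval ![u, v] (pderiv 1 P) * d v := by
      intro d P
      induction P using MvPolynomial.induction_on with
      | C a => simp
      | add p q hp hq => simp only [map_add, hp, hq]; ring
      | mul_X p i hp =>
        rw [map_mul, d.leibniz, hp]
        simp only [pderiv_mul, map_add, map_mul, aeval_X, smul_eq_mul]
        fin_cases i <;> simp [pderiv_X, Pi.single_apply] <;> ring
    have hz : ∀ P : MvPolynomial (Fin 2) k, aeval ![u, v] P = 0 →
        ∀ i, aeval ![u, v] (pderiv i P) = 0 := by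
      intro P hP i
      have h1 := chain (jacD v s) P
      have h2 := chain (jacD s u) P
      have e1 : jacD v s u = jacD u v s := by rw [jacD_apply, jacD_apply]; ring
      have e2 : jacD s u v = jacD u v s := by rw [jacD_apply, jacD_apply]; ring
      rw [hP, map_zero, jacD_left, e1, mul_zero, add_zero] at h1
      rw [hP, map_zero, jacD_right, e2, mul_zero, zero_add] at h2
      have h1' := (mul_eq_zero.1 h1.symm).resolve_right h.jac_ne
      have h2' := (mul_eq_zero.1 h2.symm).resolve_right h.jac_ne
      fin_cases i
      · exact h1'
      · exact h2'
    intro n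
    induction n with
    | zero =>
      intro P hP hP0
      rw [totalDegree_eq_zero_iff_eq_C.1 (Nat.le_zero.1 hP)] at hP0 ⊢
      simpa using hP0
    | succ n ih =>
      intro P hP hP0
      have hd : ∀ i, pderiv i P = 0 := by
        intro i
        by_contra hne
        have := totalDegree_pderiv_lt P i hne
        exact hne (ih _ (by omega) (hz P hP0 i))
      rw [pderiv_zero_const P hd] at hP0 ⊢
      simpa using hP0
  exact fun P hP => key _ P le_rfl hP

theorem Cfg.no_common (h : Cfg D s u v) {q : MvPolynomial (Fin 3) k} (hq : D q = 0)
    (hu : q ∣ u) (hv : q ∣ v) : IsUnit q := by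
  have hind := h.algInd
  have hu0 : u ≠ 0 := hind.ne_zero 0
  have hv0 : v ≠ 0 := hind.ne_zero 1
  have hrange : ∀ r, D r = 0 → ∃ P : MvPolynomial (Fin 2) k, aeval ![u, v] P = r := by
    intro r hr
    have := (h.ker r).1 hr
    have e : ({u, v} : Set (MvPolynomial (Fin 3) k)) = Set.range ![u, v] := by
      ext; simp [Fin.exists_fin_two, eq_comm, or_comm]
    rw [e, Algebra.adjoin_range_eq_range_aeval] at this
    exact this
  obtain ⟨α, hα⟩ := hu
  obtain ⟨β, hβ⟩ := hv
  obtain ⟨Q, hQ⟩ := hrange q hq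
  obtain ⟨P, hP⟩ := hrange α (fact_closed_dvd D h.lnd hu0 h.Du (Dvd.intro_left q hα.symm))
  obtain ⟨P', hP'⟩ := hrange β (fact_closed_dvd D h.lnd hv0 h.Dv (Dvd.intro_left q hβ.symm))
  have e1 : X 0 = Q * P := hind (by rw [map_mul, hQ, hP, ← hα]; exact aeval_X _ _)
  have e2 : X 1 = Q * P' := hind (by rw [map_mul, hQ, hP', ← hβ]; exact aeval_X _ _)
  have hirr : Irreducible (X 0 : MvPolynomial (Fin 2) k) := (MvPolynomial.X_prime).irreducible
  rcases hirr.isUnit_or_isUnit e1 with h1 | h1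
  · rw [← hQ]; exact h1.map (aeval ![u, v])
  · exfalso
    have h2 : (X 0 : MvPolynomial (Fin 2) k) ∣ Q := by
      rw [e1]; exact (h1.dvd_mul_right.1 dvd_rfl) 
    have h3 : (X 0 : MvPolynomial (Fin 2) k) ∣ X 1 := h2.trans (Dvd.intro _ e2.symm)
    rw [X_dvd_X] at h3
    simp at h3


theorem isWH_map {M σ : Type} [AddCommMonoid M] (φ : ℕ →+ M) {w : σ → ℕ}
    {p : MvPolynomial σ k} {n : ℕ} (h : p.IsWeightedHomogeneous w n) :
    p.IsWeightedHomogeneous (fun i => φ (w i)) (φ n) := by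
  intro d hd
  rw [← h hd]
  simp only [Finsupp.weight_apply, Finsupp.sum, map_sum, map_nsmul]

theorem isWH_int {σ : Type} {w : σ → ℕ}
    {p : MvPolynomial σ k} {n : ℤ} (h : p.IsWeightedHomogeneous (fun i => (w i : ℤ)) n)
    (hp : p ≠ 0) : ∃ N : ℕ, (N : ℤ) = n ∧ p.IsWeightedHomogeneous w N := by
  have hw : ∀ d : σ →₀ ℕ, Finsupp.weight (fun i => (w i : ℤ)) d = ((Finsupp.weight w d : ℕ) : ℤ) := by
    intro d; simp [Finsupp.weight_apply, Finsupp.sum]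
  obtain ⟨d, hd⟩ := ne_zero_iff.1 hp
  refine ⟨Finsupp.weight w d, by rw [← hw, h hd], fun e he => ?_⟩
  have := (h he).trans (h hd).symm
  rw [hw, hw] at this
  exact_mod_cast this

theorem jac_wh {w : Fin 3 → ℕ} {p q r : MvPolynomial (Fin 3) k} {a b c : ℕ}
    (hp : p.IsWeightedHomogeneous w a) (hq : q.IsWeightedHomogeneous w b)
    (hr : r.IsWeightedHomogeneous w c) (hne : jacD p q r ≠ 0) :
    ∃ N : ℕ, N + (w 0 + w 1 + w 2) = a + b + c ∧ (jacD p q r).IsWeightedHomogeneous w N := by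
  have key : ∀ {f : MvPolynomial (Fin 3) k} {n : ℕ}, f.IsWeightedHomogeneous w n → ∀ i,
      (pderiv i f).IsWeightedHomogeneous (fun i => (w i : ℤ)) ((n : ℤ) - w i) := by
    intro f n hf i
    have h1 := isWH_map (Nat.castAddMonoidHom ℤ) hf
    exact IsWeightedHomogeneous.pderiv (w := fun i => (w i : ℤ)) h1 (by simp)
  have hJ : (jacD p q r).IsWeightedHomogeneous (fun i => (w i : ℤ))
      ((a : ℤ) + b + c - (w 0 + w 1 + w 2)) := by
    have cv : ∀ {f : MvPolynomial (Fin 3) k} {m n : ℤ},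
        f.IsWeightedHomogeneous (fun i => (w i : ℤ)) m → m = n →
        f.IsWeightedHomogeneous (fun i => (w i : ℤ)) n := by
      rintro f m n h rfl; exact h
    have t : ∀ i j l : Fin 3, (w i : ℤ) + w j + w l = w 0 + w 1 + w 2 →
        (pderiv i p * pderiv j q * pderiv l r).IsWeightedHomogeneous (fun i => (w i : ℤ))
        ((a : ℤ) + b + c - (w 0 + w 1 + w 2)) := by
      intro i j l e
      exact cv (((key hp i).mul (key hq j)).mul (key hr l)) (by linarith)
    rw [jacD_apply, sub_mul, sub_mul, sub_mul]
    refine IsWeightedHomogeneous.add (IsWeightedHomogeneous.add (IsWeightedHomogeneous.sub ?_ ?_)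
      (IsWeightedHomogeneous.sub ?_ ?_)) (IsWeightedHomogeneous.sub ?_ ?_) <;>
    exact t _ _ _ (by ring)
  obtain ⟨N, hN, hh⟩ := isWH_int hJ hne
  exact ⟨N, by have : ((N + (w 0 + w 1 + w 2) : ℕ) : ℤ) = ((a + b + c : ℕ) : ℤ) := by
                push_cast; linarith
               exact_mod_cast this, hh⟩

def eul (w : Fin 3 → ℕ) :
    Derivation k (MvPolynomial (Fin 3) k) (MvPolynomial (Fin 3) k) :=
  (((w 0 : ℕ) : MvPolynomial (Fin 3) k) * X 0) • pderiv 0 +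
  (((w 1 : ℕ) : MvPolynomial (Fin 3) k) * X 1) • pderiv 1 +
  (((w 2 : ℕ) : MvPolynomial (Fin 3) k) * X 2) • pderiv 2

theorem eul_apply (w : Fin 3 → ℕ) (p : MvPolynomial (Fin 3) k) : eul w p =
  ((w 0 : ℕ) : MvPolynomial (Fin 3) k) * X 0 * pderiv 0 p +
  ((w 1 : ℕ) : MvPolynomial (Fin 3) k) * X 1 * pderiv 1 p +
  ((w 2 : ℕ) : MvPolynomial (Fin 3) k) * X 2 * pderiv 2 p := by
  simp [eul]

theorem eul_wh {w : Fin 3 → ℕ} {p : MvPolynomial (Fin 3) k} {n : ℕ}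
    (h : p.IsWeightedHomogeneous w n) : eul w p = (n : MvPolynomial (Fin 3) k) * p := by
  have := h.sum_weight_X_mul_pderiv
  rw [Fin.sum_univ_three] at this
  simp only [nsmul_eq_mul] at this
  rw [eul_apply, ← this]
  ring

theorem isUnit_natCast {n : ℕ} (hn : n ≠ 0) : IsUnit (n : MvPolynomial (Fin 3) k) := by
  have : (n : MvPolynomial (Fin 3) k) = C (n : k) := by simp
  rw [this]
  exact (IsUnit.mk0 (n : k) (by exact_mod_cast hn)).map C

theorem dvd_der_of_prime (E : Derivation k (MvPolynomial (Fin 3) k) (MvPolynomial (Fin 3) k))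
    {q J l : MvPolynomial (Fin 3) k} (hq : Prime q) (hJ : J ≠ 0) (hqJ : q ∣ J)
    (hE : E J = l * J) : q ∣ E q := by
  obtain ⟨g, hg, hg'⟩ := (FiniteMultiplicity.of_prime_left hq hJ).exists_eq_pow_mul_and_not_dvd
  generalize multiplicity q J = e at hg
  cases e with
  | zero =>
    exfalso; rw [pow_zero, one_mul] at hg; exact hg' (hg ▸ hqJ)
  | succ e =>
    rw [hg, E.leibniz, E.leibniz_pow] at hE
    simp only [smul_eq_mul, nsmul_eq_mul, Nat.add_sub_cancel] at hE
    have h1 : q ^ e * ((((e+1 : ℕ) : MvPolynomial (Fin 3) k) * (g * E q)))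
        = q ^ e * (q * (l * g - E g)) := by
      linear_combination hE
    have h2 := mul_left_cancel₀ (pow_ne_zero e hq.ne_zero) h1
    have h3 : q ∣ ((e+1 : ℕ) : MvPolynomial (Fin 3) k) * (g * E q) := Dvd.intro _ h2.symm
    rw [(isUnit_natCast (k := k) (Nat.succ_ne_zero e)).dvd_mul_left] at h3
    exact (hq.dvd_or_dvd h3).resolve_left hg'

theorem exists_pderiv_not_dvd {q : MvPolynomial (Fin 3) k} (hq : Prime q) :
    ∃ i, ¬ q ∣ pderiv i q := by
  by_contra hcon
  push Not at hcon
  have : ∀ i, pderiv i q = 0 := by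
    intro i
    by_contra hne
    have h1 := totalDegree_pderiv_lt q i hne
    have h2 := totalDegree_le_of_dvd_of_isDomain (hcon i) hne
    omega
  have hC := pderiv_zero_const q this
  apply hq.not_unit
  have h0 : coeff 0 q ≠ 0 := by
    intro h0; rw [h0, C_0] at hC; exact hq.ne_zero hC
  rw [hC]
  exact (IsUnit.mk0 _ h0).map C

theorem wh_zero_pderiv {w : Fin 3 → ℕ} (hw : ∀ i, 0 < w i) {p : MvPolynomial (Fin 3) k}
    (h : p.IsWeightedHomogeneous w 0) (i : Fin 3) : pderiv i p = 0 := by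
  ext m
  rw [coeff_pderiv, coeff_zero]
  by_cases hc : coeff (m + Finsupp.single i 1) p = 0
  · rw [hc, zero_mul]
  · exfalso
    have := h hc
    rw [map_add, Finsupp.weight_single, one_smul] at this
    have := hw i
    omega

theorem Cfg.du_ne (h : Cfg D s u v) {w : Fin 3 → ℕ} (hw : ∀ i, 0 < w i) {du : ℕ}
    (hu : u.IsWeightedHomogeneous w du) : du ≠ 0 := by
  rintro rfl
  apply h.jac_ne
  rw [jacD_apply]
  simp [wh_zero_pderiv hw hu]

theorem Cfg.prime_dvd_u (h : Cfg D s u v) {w : Fin 3 → ℕ} (hw : ∀ i, 0 < w i) {du dv : ℕ}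
    (hu : u.IsWeightedHomogeneous w du) {q : MvPolynomial (Fin 3) k} (hq : Prime q)
    (hqD : D q = 0) (hqE : q ∣ eul w q) (hqw : ∀ r, q ∣ jacD u v r) : q ∣ u := by
  obtain ⟨g1, g2, hg⟩ := adjoin_pair_deriv u v ((h.ker q).1 hqD)
  obtain ⟨i, hi⟩ := exists_pderiv_not_dvd hq
  have hcross : ∀ i, q ∣ eul w u * pderiv i v - eul w v * pderiv i u := by
    have h0 : q ∣ pderiv 1 u * pderiv 2 v - pderiv 2 u * pderiv 1 v := by
      have := hqw (X 0); rw [jacD_apply] at this; simpa [pderiv_X] using this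
    have h1 : q ∣ pderiv 2 u * pderiv 0 v - pderiv 0 u * pderiv 2 v := by
      have := hqw (X 1); rw [jacD_apply] at this; simpa [pderiv_X] using this
    have h2 : q ∣ pderiv 0 u * pderiv 1 v - pderiv 1 u * pderiv 0 v := by
      have := hqw (X 2); rw [jacD_apply] at this; simpa [pderiv_X] using this
    obtain ⟨m0, h0⟩ := h0
    obtain ⟨m1, h1⟩ := h1
    obtain ⟨m2, h2⟩ := h2
    intro i
    rw [eul_apply, eul_apply]
    fin_cases i <;> simp only [Fin.zero_eta, Fin.mk_one, Fin.reduceFinMk]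
    · refine ⟨(w 2 : MvPolynomial (Fin 3) k) * X 2 * m1 - (w 1 : MvPolynomial (Fin 3) k) * X 1 * m2, ?_⟩
      linear_combination (w 2 : MvPolynomial (Fin 3) k) * X 2 * h1 - (w 1 : MvPolynomial (Fin 3) k) * X 1 * h2
    · refine ⟨(w 0 : MvPolynomial (Fin 3) k) * X 0 * m2 - (w 2 : MvPolynomial (Fin 3) k) * X 2 * m0, ?_⟩
      linear_combination (w 0 : MvPolynomial (Fin 3) k) * X 0 * h2 - (w 2 : MvPolynomial (Fin 3) k) * X 2 * h0
    · refine ⟨(w 1 : MvPolynomial (Fin 3) k) * X 1 * m0 - (w 0 : MvPolynomial (Fin 3) k) * X 0 * m1, ?_⟩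
      linear_combination (w 1 : MvPolynomial (Fin 3) k) * X 1 * h0 - (w 0 : MvPolynomial (Fin 3) k) * X 0 * h1
  have h1 : q ∣ eul w u * pderiv i q := by
    have e : eul w u * pderiv i q = pderiv i u * eul w q
        + g2 * (eul w u * pderiv i v - eul w v * pderiv i u) := by
      rw [hg (pderiv i), hg (eul w)]; ring
    rw [e]
    exact dvd_add (hqE.mul_left _) ((hcross i).mul_left _)
  have h2 := (hq.dvd_or_dvd h1).resolve_right hi
  rw [eul_wh hu] at h2
  rwa [(isUnit_natCast (k := k) (h.du_ne hw hu)).dvd_mul_left] at h2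

theorem Cfg.jac_const (h : Cfg D s u v) (hirr : IsIrreducibleDeriv D) {w : Fin 3 → ℕ}
    (hw : ∀ i, 0 < w i) {du dv ds : ℕ}
    (hu : u.IsWeightedHomogeneous w du) (hv : v.IsWeightedHomogeneous w dv)
    (hs : s.IsWeightedHomogeneous w ds) :
    ∃ c : k, c ≠ 0 ∧ ∀ r, jacD u v r = C c * D r := by
  obtain ⟨g, hg⟩ := h.exists_h hirr
  have hgJ : g ∣ jacD u v s := Dvd.intro _ (hg s).symm
  have hg0 : g ≠ 0 := ne_zero_of_dvd_ne_zero h.jac_ne hgJ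
  have hunit : IsUnit g := by
    by_contra hnu
    obtain ⟨q, hqi, hqg⟩ := WfDvdMonoid.exists_irreducible_factor hnu hg0
    have hq : Prime q := hqi.prime
    have hqJ := hqg.trans hgJ
    have hqD : D q = 0 := fact_closed_dvd D h.lnd h.jac_ne h.jac_ker hqJ
    obtain ⟨N, -, hN⟩ := jac_wh hu hv hs h.jac_ne
    have hqE : q ∣ eul w q := dvd_der_of_prime (eul w) hq h.jac_ne hqJ (eul_wh hN)
    have hqw : ∀ r, q ∣ jacD u v r := fun r => (hqg.trans (Dvd.intro _ (hg r).symm))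
    have hqu := h.prime_dvd_u hw (dv := dv) hu hq hqD hqE hqw
    have hqv := h.swap.prime_dvd_u hw (dv := du) hv hq hqD hqE (fun r => by
      have e : jacD v u r = - jacD u v r := by rw [jacD_apply, jacD_apply]; ring
      rw [e, dvd_neg]; exact hqw r)
    exact hq.not_unit (h.no_common hqD hqu hqv)
  obtain ⟨c, hc, rfl⟩ := isUnit_iff_eq_C_of_isReduced.1 hunit
  exact ⟨c, hc.ne_zero, hg⟩

theorem Cfg.partA (h : Cfg D s u v) (hirr : IsIrreducibleDeriv D) {w : Fin 3 → ℕ}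
    (hw : ∀ i, 0 < w i) {du dv ds : ℕ}
    (hu : u.IsWeightedHomogeneous w du) (hv : v.IsWeightedHomogeneous w dv)
    (hs : s.IsWeightedHomogeneous w ds)
    (hsnk : ∀ δ : Derivation k (MvPolynomial (Fin 3) k) (MvPolynomial (Fin 3) k),
      IsLND δ → δ ≠ 0 → δ s ≠ 0) :
    D s ∉ Algebra.adjoin k ({u} : Set (MvPolynomial (Fin 3) k)) := by
  intro hmem
  obtain ⟨c, hc, hcD⟩ := h.jac_const hirr hw hu hv hs
  have hf : jacD u s (D s) = 0 := by
    obtain ⟨g1, g2, hg⟩ := adjoin_pair_deriv u u (p := D s) (by simpa using hmem)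
    rw [hg, jacD_left]; ring
  have hv1 : jacD u s v = - (C c * D s) := by rw [jacD_swap, hcD]
  have hv2 : jacD u s (jacD u s v) = 0 := by
    rw [hv1, map_neg, Derivation.leibniz, derivation_C, hf]; simp
  refine hsnk (jacD u s) ?_ ?_ (jacD_right u s)
  · intro r
    obtain ⟨N, hN⟩ := slice_adjoin D h.lnd s h.d2 u v h.ker r
    obtain ⟨n, hn⟩ := der_nil_adjoin (jacD u s) {u, v, s} (by
      rintro x (rfl | rfl | hx)
      · exact ⟨1, jacD_left _ _⟩
      · exact ⟨2, hv2⟩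
      · rw [Set.mem_singleton_iff.1 hx]; exact ⟨1, jacD_right _ _⟩) hN
    refine ⟨n, ?_⟩
    rw [der_iter_mul _ _ _ _ (by rw [Derivation.leibniz_pow, hf]; simp)] at hn
    exact (mul_eq_zero.1 hn).resolve_left (pow_ne_zero _ h.ne)
  · intro h0
    rw [h0, Derivation.zero_apply, eq_comm, neg_eq_zero] at hv1
    exact mul_ne_zero (by simpa using hc) h.ne hv1

theorem span_of_wh {w : Fin 3 → ℕ} {du dv N : ℕ}
    (hu : u.IsWeightedHomogeneous w du) (hv : v.IsWeightedHomogeneous w dv)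
    {f : MvPolynomial (Fin 3) k}
    (hf : f ∈ Algebra.adjoin k ({u, v} : Set (MvPolynomial (Fin 3) k)))
    (hN : f.IsWeightedHomogeneous w N) :
    f ∈ Submodule.span k {x | ∃ i j : ℕ, i * du + j * dv = N ∧ x = u^i * v^j} := by
  have e : ({u, v} : Set (MvPolynomial (Fin 3) k)) = Set.range ![u, v] := by
    ext; simp [Fin.exists_fin_two, eq_comm, or_comm]
  rw [e, Algebra.adjoin_range_eq_range_aeval] at hf
  obtain ⟨P, hP⟩ := hf
  have hP' : aeval ![u, v] P = f := hP
  rw [P.as_sum, map_sum] at hP'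
  rw [← hN.weightedHomogeneousComponent_same, ← hP', map_sum]
  refine Submodule.sum_mem _ fun d _ => ?_
  have : aeval ![u, v] (monomial d (coeff d P)) = coeff d P • (u^(d 0) * v^(d 1)) := by
    rw [aeval_monomial, Finsupp.prod_fintype _ _ (by simp), Algebra.smul_def]
    simp
  rw [this, map_smul]
  apply Submodule.smul_mem
  have hh : (u^(d 0) * v^(d 1)).IsWeightedHomogeneous w (d 0 * du + d 1 * dv) := by
    simpa using (hu.pow (d 0)).mul (hv.pow (d 1))
  by_cases hd : d 0 * du + d 1 * dv = N
  · rw [hd] at hh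
    rw [hh.weightedHomogeneousComponent_same]
    exact Submodule.subset_span ⟨_, _, hd, rfl⟩
  · rw [hh.weightedHomogeneousComponent_ne _ (Ne.symm hd)]
    exact Submodule.zero_mem _

attribute [local instance] MvPolynomial.weightedGradedAlgebra in
theorem comp_dvd {M : Type} [AddCommMonoid M] [DecidableEq M] (w : Fin 3 → M)
    {s p : MvPolynomial (Fin 3) k} {n : M} (hs : s.IsWeightedHomogeneous w n) (hp : s ∣ p) (m : M) :
    s ∣ weightedHomogeneousComponent w m p := by
  rw [← Ideal.mem_span_singleton] at hp ⊢
  refine weightedHomogeneousComponent_mem_of_mem k w ?_ hp m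
  apply Ideal.homogeneous_span
  rintro x hx
  rw [Set.mem_singleton_iff.1 hx]
  exact ⟨n, hs⟩

theorem Cfg.coprime (h : Cfg D s u v) {w : Fin 3 → ℕ} {du dv ds d : ℕ}
    (hu : u.IsWeightedHomogeneous w du) (hv : v.IsWeightedHomogeneous w dv)
    (hs : s.IsWeightedHomogeneous w ds) (hdu : d ∣ du) (hdv : d ∣ dv)
    {i j : Fin 3} (hij : i ≠ j) (hi : ¬ d ∣ w i) (hj : ¬ d ∣ w j) : False := by
  classical
  let φ : ℕ →+ ZMod d := Nat.castAddMonoidHom (ZMod d)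
  have hu' := isWH_map φ hu
  have hv' := isWH_map φ hv
  have hs' := isWH_map φ hs
  have eu : φ du = 0 := (ZMod.natCast_eq_zero_iff _ _).2 hdu
  have ev : φ dv = 0 := (ZMod.natCast_eq_zero_iff _ _).2 hdv
  rw [eu] at hu'
  rw [ev] at hv'
  have hA : ∀ r, D r = 0 → r.IsWeightedHomogeneous (fun i => φ (w i)) 0 := by
    intro r hr
    have := (h.ker r).1 hr
    induction this using Algebra.adjoin_induction with
    | mem x hx =>
      rcases hx with rfl | hx
      · exact hu'
      · rw [Set.mem_singleton_iff.1 hx]; exact hv'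
    | algebraMap r => exact isWeightedHomogeneous_C _ _
    | add x y hx' hy' hx hy => exact (hx ((h.ker _).2 hx')).add (hy ((h.ker _).2 hy'))
    | mul x y hx' hy' hx hy =>
      simpa using (hx ((h.ker _).2 hx')).mul (hy ((h.ker _).2 hy'))
  have key : ∀ i, ¬ d ∣ w i → ∃ N, s ∣ (D s)^N * X i := by
    intro i hi
    obtain ⟨N, α, hα, hdiv⟩ := slice_mod D h.lnd s h.d2 (X i)
    refine ⟨N, ?_⟩
    have h1 := comp_dvd (fun i => φ (w i)) hs' hdiv (φ (w i))
    have h2 : ((D s)^N * X i).IsWeightedHomogeneous (fun i => φ (w i)) (φ (w i)) := by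
      have := (hA _ (h.dpow N)).mul (isWeightedHomogeneous_X k (fun i => φ (w i)) i)
      rwa [zero_add] at this
    have hne : φ (w i) ≠ 0 := fun h0 => hi ((ZMod.natCast_eq_zero_iff _ _).1 h0)
    rwa [map_sub, h2.weightedHomogeneousComponent_same,
      (hA α hα).weightedHomogeneousComponent_ne _ hne, sub_zero] at h1
  obtain ⟨N1, h1⟩ := key i hi
  obtain ⟨N2, h2⟩ := key j hj
  have h1' : s ∣ (D s)^(N1+N2) * X i := by
    rw [pow_add, mul_right_comm]; exact h1.mul_right _
  have h2' : s ∣ (D s)^(N1+N2) * X j := by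
    rw [pow_add, mul_assoc]; exact h2.mul_left _
  let _ : GCDMonoid (MvPolynomial (Fin 3) k) := UniqueFactorizationMonoid.toGCDMonoid _
  have h3 : s ∣ (D s)^(N1+N2) * gcd (X i) (X j) :=
    (dvd_gcd h1' h2').trans (gcd_mul_left' _ _ _).dvd
  have hg : IsUnit (gcd (X i : MvPolynomial (Fin 3) k) (X j)) := by
    have hirr : Irreducible (X i : MvPolynomial (Fin 3) k) := (MvPolynomial.X_prime).irreducible
    by_contra hnu
    obtain ⟨t, ht⟩ := gcd_dvd_left (X i : MvPolynomial (Fin 3) k) (X j)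
    have ht' := (hirr.isUnit_or_isUnit ht).resolve_left hnu
    have : (X i : MvPolynomial (Fin 3) k) ∣ X j := by
      have e : (X i : MvPolynomial (Fin 3) k) ∣ gcd (X i) (X j) := by
        conv_lhs => rw [ht]
        exact ht'.dvd_mul_right.1 dvd_rfl
      exact e.trans (gcd_dvd_right _ _)
    rw [X_dvd_X] at this
    exact hij this
  rw [hg.dvd_mul_right] at h3
  exact h.ne (fact_closed_dvd D h.lnd (pow_ne_zero _ h.ne) (h.dpow _) h3)

theorem Cfg.partB (h : Cfg D s u v) (hirr : IsIrreducibleDeriv D) {w : Fin 3 → ℕ}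
    (hw : ∀ i, 0 < w i) {du dv ds : ℕ}
    (hu : u.IsWeightedHomogeneous w du) (hv : v.IsWeightedHomogeneous w dv)
    (hs : s.IsWeightedHomogeneous w ds)
    (hsnk : ∀ δ : Derivation k (MvPolynomial (Fin 3) k) (MvPolynomial (Fin 3) k),
      IsLND δ → δ ≠ 0 → δ s ≠ 0)
    (hcop : ∀ d, 1 < d → ∃ i j : Fin 3, i ≠ j ∧ ¬ d ∣ w i ∧ ¬ d ∣ w j)
    (hle : du ≤ dv) (h2 : 2 < du) (hne : ds ≠ w 0 + w 1 + w 2)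
    (hlt : ds < du + (w 0 + w 1 + w 2)) : False := by
  obtain ⟨c, hc, hcD⟩ := h.jac_const hirr hw hu hv hs
  obtain ⟨N, hN, hJ⟩ := jac_wh hu hv hs h.jac_ne
  have hfN : (D s).IsWeightedHomogeneous w N := by
    have e : D s = C c⁻¹ * jacD u v s := by
      rw [hcD, ← mul_assoc, ← C_mul, inv_mul_cancel₀ hc, C_1, one_mul]
    rw [e]; exact hJ.C_mul _
  have hspan := span_of_wh hu hv ((h.ker _).1 h.d2) hfN
  have hmix : ∀ i j : ℕ, i * du + j * dv = N → i = 0 ∨ j = 0 := by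
    intro i j e
    by_contra hcon
    push Not at hcon
    obtain ⟨i, rfl⟩ := Nat.exists_eq_succ_of_ne_zero hcon.1
    obtain ⟨j, rfl⟩ := Nat.exists_eq_succ_of_ne_zero hcon.2
    rcases Nat.eq_zero_or_pos i with rfl | hi
    · rcases Nat.eq_zero_or_pos j with rfl | hj
      · simp at e; omega
      · have : 2 * dv ≤ (j + 1) * dv := Nat.mul_le_mul_right _ (by omega)
        simp only [Nat.succ_eq_add_one] at e
        omega
    · have : 2 * du ≤ (i + 1) * du := Nat.mul_le_mul_right _ (by omega)
      have : 1 * dv ≤ (j + 1) * dv := Nat.mul_le_mul_right _ (by omega)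
      simp only [Nat.succ_eq_add_one] at e
      omega
  have hAu := h.partA hirr hw hu hv hs hsnk
  have hAv := h.swap.partA hirr hw hv hu hs hsnk
  have hj : ∃ j, j ≠ 0 ∧ j * dv = N := by
    by_contra hcon
    push Not at hcon
    apply hAu
    have : Submodule.span k {x | ∃ i j : ℕ, i * du + j * dv = N ∧ x = u^i * v^j} ≤
        Subalgebra.toSubmodule (Algebra.adjoin k ({u} : Set (MvPolynomial (Fin 3) k))) := by
      rw [Submodule.span_le]
      rintro x ⟨i, j, e, rfl⟩
      have hj0 : j = 0 := by
        by_contra hj0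
        have hi0 := (hmix i j e).resolve_right hj0
        subst hi0
        exact hcon j hj0 (by simpa using e)
      subst hj0
      simpa using Subalgebra.pow_mem _ (Algebra.subset_adjoin (Set.mem_singleton u)) i
    exact this hspan
  have hi : ∃ i, i ≠ 0 ∧ i * du = N := by
    by_contra hcon
    push Not at hcon
    apply hAv
    have : Submodule.span k {x | ∃ i j : ℕ, i * du + j * dv = N ∧ x = u^i * v^j} ≤
        Subalgebra.toSubmodule (Algebra.adjoin k ({v} : Set (MvPolynomial (Fin 3) k))) := by
      rw [Submodule.span_le]
      rintro x ⟨i, j, e, rfl⟩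
      have hi0 : i = 0 := by
        by_contra hi0
        have hj0 := (hmix i j e).resolve_left hi0
        subst hj0
        exact hcon i hi0 (by simpa using e)
      subst hi0
      simpa using Subalgebra.pow_mem _ (Algebra.subset_adjoin (Set.mem_singleton v)) j
    exact this hspan
  obtain ⟨j, hj0, hj⟩ := hj
  obtain ⟨i, hi0, hi⟩ := hi
  have hj2 : j < 3 := by
    by_contra hcon
    have : 3 * dv ≤ j * dv := Nat.mul_le_mul_right _ (by omega)
    omega
  interval_cases j
  · exact hj0 rfl
  · -- Ds = g(u) + β v
    have hsup : D s ∈ Subalgebra.toSubmodule (Algebra.adjoin k ({u} : Set (MvPolynomial (Fin 3) k)))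
        ⊔ Submodule.span k {v} := by
      refine (Submodule.span_le.2 ?_) hspan
      rintro x ⟨i, j, e, rfl⟩
      rcases hmix i j e with rfl | rfl
      · have : j = 1 := by
          have hdv : 0 < dv := by omega
          apply Nat.eq_of_mul_eq_mul_right hdv
          omega
        subst this
        apply Submodule.mem_sup_right
        simpa using Submodule.mem_span_singleton_self v
      · apply Submodule.mem_sup_left
        simpa using Subalgebra.pow_mem _ (Algebra.subset_adjoin (Set.mem_singleton u)) i
    obtain ⟨g, hg, y, hy, e⟩ := Submodule.mem_sup.1 hsup
    obtain ⟨β, rfl⟩ := Submodule.mem_span_singleton.1 hy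
    have hg' : g ∈ Algebra.adjoin k ({u} : Set (MvPolynomial (Fin 3) k)) := hg
    have hβ : β ≠ 0 := by
      rintro rfl
      apply hAu
      rw [← e]; simpa using hg'
    have hcfg : Cfg D s (D s) u := by
      refine ⟨h.lnd, h.d2, h.ne, fun r => ?_⟩
      rw [h.ker]
      have : Algebra.adjoin k ({u, v} : Set (MvPolynomial (Fin 3) k)) =
          Algebra.adjoin k ({D s, u} : Set (MvPolynomial (Fin 3) k)) := by
        apply le_antisymm
        · rw [Algebra.adjoin_le_iff]
          rintro x (rfl | hx)
          · exact Algebra.subset_adjoin (by simp)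
          · rw [Set.mem_singleton_iff.1 hx]
            have e' : v = β⁻¹ • (D s - g) := by
              rw [← e, add_sub_cancel_left, smul_smul, inv_mul_cancel₀ hβ, one_smul]
            rw [e']
            apply Subalgebra.smul_mem
            apply Subalgebra.sub_mem
            · exact Algebra.subset_adjoin (by simp)
            · exact Algebra.adjoin_mono (by simp) hg'
        · rw [Algebra.adjoin_le_iff]
          rintro x (rfl | hx)
          · exact (h.ker _).1 h.d2
          · rw [Set.mem_singleton_iff.1 hx]
            exact Algebra.subset_adjoin (by simp)
      rw [this]
    exact hcfg.partA hirr hw hfN hu hs hsnk (Algebra.subset_adjoin (by simp))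
  · have hi4 : i < 4 := by
      by_contra hcon
      have : 4 * du ≤ i * du := Nat.mul_le_mul_right _ (by omega)
      omega
    interval_cases i
    · omega
    · omega
    · obtain ⟨i, j, hij, h3, h4⟩ := hcop du (by omega)
      exact h.coprime hu hv hs dvd_rfl (by rw [show dv = du by omega]) hij h3 h4
    · obtain ⟨i, j, hij, h3, h4⟩ := hcop (dv - du) (by omega)
      exact h.coprime hu hv hs (Dvd.intro_left 2 (by omega)) (Dvd.intro_left 3 (by omega)) hij h3 h4

end three

/-- Lemma 2.8: let `a, b, c` be pairwise coprime positive weights on `R = k[x,y,z]`,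
let `s` be a nonzero homogeneous element such that `δ s ≠ 0` for every nonzero locally
nilpotent derivation `δ`, and let `D` be an irreducible homogeneous locally nilpotent
derivation with `D² s = 0` and `ker D = k[u,v]` for homogeneous `u, v`. Then
(a) `Ds ∉ k[u]` and `Ds ∉ k[v]`;
(b) if `deg s ≠ a + b + c` then `min (deg u, deg v) ≤ max {2, deg s - (a+b+c)}`. -/
theorem statement_6 (k : Type) [Field k] [CharZero k] (a b c : ℕ)
    (ha : 0 < a) (hb : 0 < b) (hc : 0 < c)
    (hab : Nat.Coprime a b) (hac : Nat.Coprime a c) (hbc : Nat.Coprime b c)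
    (s : MvPolynomial (Fin 3) k) (hs0 : s ≠ 0) (ds : ℕ)
    (hs : s.IsWeightedHomogeneous ![a, b, c] ds)
    (hsnk : ∀ δ : Derivation k (MvPolynomial (Fin 3) k) (MvPolynomial (Fin 3) k),
      IsLND δ → δ ≠ 0 → δ s ≠ 0)
    (D : Derivation k (MvPolynomial (Fin 3) k) (MvPolynomial (Fin 3) k))
    (hlnd : IsLND D) (hirr : IsIrreducibleDeriv D)
    (hhom : ∃ m : ℤ, DerivIsHomogOfDeg ![a, b, c] D m)
    (hD2s : D (D s) = 0)
    (u v : MvPolynomial (Fin 3) k) (du dv : ℕ)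
    (hu : u.IsWeightedHomogeneous ![a, b, c] du)
    (hv : v.IsWeightedHomogeneous ![a, b, c] dv)
    (hker : ∀ r : MvPolynomial (Fin 3) k,
      D r = 0 ↔ r ∈ Algebra.adjoin k ({u, v} : Set (MvPolynomial (Fin 3) k))) :
    (D s ∉ Algebra.adjoin k ({u} : Set (MvPolynomial (Fin 3) k)) ∧
     D s ∉ Algebra.adjoin k ({v} : Set (MvPolynomial (Fin 3) k))) ∧
    ((ds : ℤ) ≠ (a : ℤ) + b + c →
      min (du : ℤ) (dv : ℤ) ≤ max 2 ((ds : ℤ) - ((a : ℤ) + b + c))) := by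
  have hD0 : D ≠ 0 := by
    rintro rfl
    exact not_isUnit_zero (hirr 0 (by simp))
  have cfg : Cfg D s u v := ⟨hlnd, hD2s, hsnk D hlnd hD0, hker⟩
  have hw : ∀ i : Fin 3, 0 < (![a, b, c] : Fin 3 → ℕ) i := by
    intro i; fin_cases i <;> simpa
  refine ⟨⟨cfg.partA hirr hw hu hv hs hsnk, cfg.swap.partA hirr hw hv hu hs hsnk⟩, fun hne => ?_⟩
  have hcop : ∀ d, 1 < d → ∃ i j : Fin 3, i ≠ j ∧ ¬ d ∣ (![a, b, c] : Fin 3 → ℕ) i ∧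
      ¬ d ∣ (![a, b, c] : Fin 3 → ℕ) j := by
    intro d hd
    have one : ¬ d ∣ 1 := fun h => by have := Nat.le_of_dvd one_pos h; omega
    by_cases h1 : d ∣ a
    · exact ⟨1, 2, by decide, fun h => one (hab ▸ Nat.dvd_gcd h1 h),
        fun h => one (hac ▸ Nat.dvd_gcd h1 h)⟩
    · by_cases h2 : d ∣ b
      · exact ⟨0, 2, by decide, h1, fun h => one (hbc ▸ Nat.dvd_gcd h2 h)⟩
      · exact ⟨0, 1, by decide, h1, h2⟩
  by_contra hcon
  rw [not_le, max_lt_iff, lt_min_iff, lt_min_iff] at hcon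
  obtain ⟨⟨h1, h2⟩, h3, h4⟩ := hcon
  rcases le_total du dv with hle | hle
  · exact cfg.partB hirr hw hu hv hs hsnk hcop hle (by omega)
      (by change ds ≠ a + b + c; omega) (by change ds < du + (a + b + c); omega)
  · exact cfg.swap.partB hirr hw hv hu hs hsnk hcop hle (by omega)
      (by change ds ≠ a + b + c; omega) (by change ds < dv + (a + b + c); omega)
end
end

section
/- Let k be an algebraically closed field of characteristic zero, R a 3-dimensional affine k-domain, and f a prime element of R. Then (a) ⇒ (b) ⇒ (c), where: (a) there exists a nonzero locally nilpotent derivation δ of R with δ(f) = 0; (b) the ring R/fR is not rigid; (c) for every ℕ-grading R = ⊕_{d∈ℕ} R_d in which f is homogeneous and R_0 = k, the projective curve Proj(R/fR) is a unicuspidal rational curve. -/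
open MvPolynomial

set_option synthInstance.maxHeartbeats 400000
set_option maxHeartbeats 1000000

noncomputable section

/-- `B` is rigid: its only locally nilpotent `k`-derivation is the zero derivation. -/
def IsRigid (k B : Type*) [CommRing k] [CommRing B] [Algebra k B] : Prop :=
  ∀ D : Derivation k B B, IsLND D → D = 0

/-- The scheme `Proj ℬ` contains an open subscheme isomorphic to the affine line `𝔸¹_k`.
A projective curve with this property is precisely a unicuspidal rational curve. -/
def ProjContainsAffineLine (k : Type) [Field k] {A : Type} [CommRing A] [Algebra k A]
    (ℬ : ℕ → Submodule k A) [GradedAlgebra ℬ] : Prop :=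
  ∃ U : (AlgebraicGeometry.Proj ℬ).Opens,
    Nonempty (U.toScheme ≅ AlgebraicGeometry.Spec (CommRingCat.of (Polynomial k)))

theorem aux_a_to_b (k : Type) [Field k]
    (R : Type) [CommRing R] [IsDomain R] [Algebra k R] [IsNoetherianRing R]
    (f : R) (hf : Prime f) (δ : Derivation k R R) (hδ : IsLND δ) (h0 : δ ≠ 0) (hδf : δ f = 0) :
    ¬ IsRigid k (R ⧸ Ideal.span {f}) := by
  classical
  have hf0 : f ≠ 0 := hf.ne_zero
  have hex : ∃ m : ℕ, ¬ ∀ x, f ^ m ∣ δ x := by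
    by_contra! hc
    apply h0
    ext x
    by_contra hx
    have := FiniteMultiplicity.of_prime_left hf hx
    exact this.not_pow_dvd_of_multiplicity_lt (Nat.lt_succ_self _) (hc _ x)
  obtain ⟨m, hm1, hm2⟩ : ∃ m : ℕ, (∀ x, f ^ m ∣ δ x) ∧ ∃ x, ¬ f ^ (m+1) ∣ δ x := by
    have hs := Nat.find_spec hex
    have hmin := fun n => Nat.find_min (m := n) hex
    rcases h : Nat.find hex with _ | n
    · rw [h] at hs; simp at hs
    · refine ⟨n, ?_, ?_⟩
      · simpa using hmin n (by omega)
      · rw [h] at hs; push Not at hs; exact hs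
  choose g hg using hm1
  have hfm : f ^ m ≠ 0 := pow_ne_zero _ hf0
  let g' : Derivation k R R := Derivation.mk'
    { toFun := g
      map_add' := fun x y => mul_left_cancel₀ hfm (by rw [← hg, map_add, mul_add, ← hg, ← hg])
      map_smul' := fun c x => mul_left_cancel₀ hfm (by
        rw [← hg, Derivation.map_smul, RingHom.id_apply, mul_smul_comm, ← hg]) }
    (fun x y => mul_left_cancel₀ hfm (by
      change f ^ m * g (x * y) = f ^ m * (x • g y + y • g x)
      rw [← hg, Derivation.leibniz, hg x, hg y]; simp only [smul_eq_mul]; ring))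
  have hg' : ∀ x, δ x = f ^ m * g' x := hg
  have hg'f : g' f = 0 := mul_left_cancel₀ hfm (by rw [← hg', hδf, mul_zero])
  have hg'fn : ∀ n, g' (f ^ n) = 0 := fun n => by rw [Derivation.leibniz_pow, hg'f]; simp
  have hδfn : ∀ n, δ (f ^ n) = 0 := fun n => by rw [Derivation.leibniz_pow, hδf]; simp
  have hit : ∀ n x, (⇑δ)^[n] x = f ^ (m * n) * (⇑g')^[n] x := by
    intro n x
    induction n with
    | zero => simp
    | succ n ih =>
      rw [Function.iterate_succ_apply', ih, Function.iterate_succ_apply', Derivation.leibniz,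
        hδfn, hg']
      simp only [smul_eq_mul]; ring
  have hln : IsLND g' := by
    intro b
    obtain ⟨n, hn⟩ := hδ b
    refine ⟨n, ?_⟩
    rw [hit] at hn
    exact (mul_eq_zero.mp hn).resolve_left (pow_ne_zero _ hf0)
  have hsurj : Function.Surjective (Ideal.Quotient.mkₐ k (Ideal.span {f})) :=
    Ideal.Quotient.mkₐ_surjective k _
  have hd : ∀ x, (Ideal.Quotient.mkₐ k (Ideal.span {f})) x = 0 →
      (Ideal.Quotient.mkₐ k (Ideal.span {f})) (g' x) = 0 := by
    intro x hx
    rw [Ideal.Quotient.mkₐ_eq_mk, Ideal.Quotient.eq_zero_iff_mem, Ideal.mem_span_singleton] at hx ⊢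
    obtain ⟨y, rfl⟩ := hx
    rw [Derivation.leibniz, hg'f]
    simp
  let q := Derivation.liftOfSurjective hsurj hd
  have hq : ∀ x, q (Ideal.Quotient.mkₐ k (Ideal.span {f}) x) =
      Ideal.Quotient.mkₐ k (Ideal.span {f}) (g' x) := fun x =>
    Derivation.liftOfSurjective_apply hsurj hd x
  intro hr
  have hq0 : q = 0 := by
    apply hr
    intro b
    obtain ⟨x, rfl⟩ := hsurj b
    obtain ⟨n, hn⟩ := hln x
    refine ⟨n, ?_⟩
    have : ∀ n, (⇑q)^[n] (Ideal.Quotient.mkₐ k (Ideal.span {f}) x) =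
        Ideal.Quotient.mkₐ k (Ideal.span {f}) ((⇑g')^[n] x) := by
      intro n
      induction n with
      | zero => rfl
      | succ n ih => rw [Function.iterate_succ_apply', ih, hq, Function.iterate_succ_apply']
    rw [this, hn, map_zero]
  obtain ⟨x, hx⟩ := hm2
  apply hx
  have := hq x
  rw [hq0, Derivation.zero_apply, eq_comm, Ideal.Quotient.mkₐ_eq_mk,
    Ideal.Quotient.eq_zero_iff_mem, Ideal.mem_span_singleton] at this
  obtain ⟨y, hy⟩ := this
  exact ⟨y, by rw [hg', hy]; ring⟩

/-- transcendence degree is bounded by Krull dimension -/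
theorem aux_trdeg_le (k : Type) [Field k] (B : Type) [CommRing B] [IsDomain B] [Algebra k B]
    [Algebra.FiniteType k B] (n : ℕ) (h : ringKrullDim B ≤ n) : Algebra.trdeg k B ≤ n := by
  obtain ⟨s, g, hinj, hint⟩ := exists_integral_inj_algHom_of_fg k B
  algebraize [g.toRingHom]
  have hinj' : Function.Injective (algebraMap (MvPolynomial (Fin s) k) B) := hinj
  have hfs : FaithfulSMul (MvPolynomial (Fin s) k) B :=
    (faithfulSMul_iff_algebraMap_injective _ _).mpr hinj'
  have h1 := trdeg_add_eq k (MvPolynomial (Fin s) k) (A := B)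
  have halg : Algebra.IsAlgebraic (MvPolynomial (Fin s) k) B := inferInstance
  rw [trdeg_eq_zero (R := MvPolynomial (Fin s) k) (A := B), add_zero,
    MvPolynomial.trdeg_of_isDomain] at h1
  rw [← h1]
  have h2 : ringKrullDim (MvPolynomial (Fin s) k) ≤ ringKrullDim B := by
    unfold ringKrullDim
    apply iSup_le
    intro l
    obtain ⟨Q, -, hQ, hQo⟩ := Ideal.exists_ideal_over_prime_of_isIntegral (S := B)
      l.head.asIdeal ⊥ (by
        rw [← RingHom.ker_eq_comap_bot, (RingHom.injective_iff_ker_eq_bot _).mp hinj']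
        exact bot_le)
    have : Q.LiesOver l.head.asIdeal := ⟨hQo.symm⟩
    obtain ⟨L, hL, -, -⟩ := Ideal.exists_ltSeries_of_hasGoingUp l Q
    rw [← hL]
    exact le_iSup (fun p : LTSeries (PrimeSpectrum B) => (p.length : WithBot ℕ∞)) L
  rw [MvPolynomial.ringKrullDim_of_isNoetherianRing, ringKrullDim_eq_zero_of_field] at h2
  have h3 := h2.trans h
  simp only [Nat.card_eq_fintype_card, Fintype.card_fin, zero_add] at h3
  have h4 : s ≤ n := by exact_mod_cast h3
  simpa using h4

theorem aux_quot_graded (k : Type) [Field k] (R : Type) [CommRing R] [Algebra k R]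
    (𝒜 : ℕ → Submodule k R) [GradedAlgebra 𝒜] (f : R) (d : ℕ) (hf : f ∈ 𝒜 d) :
    Nonempty (GradedAlgebra (fun i => (𝒜 i).map
      (Ideal.Quotient.mkₐ k (Ideal.span {f})).toLinearMap)) := by
  classical
  set π := Ideal.Quotient.mkₐ k (Ideal.span {f}) with hπ
  set ℬ : ℕ → Submodule k (R ⧸ Ideal.span {f}) := fun i => (𝒜 i).map π.toLinearMap with hℬ
  have hmem : ∀ i x, x ∈ 𝒜 i → π x ∈ ℬ i := fun i x hx => ⟨x, hx, rfl⟩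
  have : SetLike.GradedMonoid ℬ :=
    { one_mem := ⟨1, SetLike.GradedOne.one_mem, map_one π⟩
      mul_mem := by
        rintro i j _ _ ⟨x, hx, rfl⟩ ⟨y, hy, rfl⟩
        exact ⟨x * y, SetLike.GradedMul.mul_mem hx hy, map_mul π x y⟩ }
  let φ : (DirectSum ℕ fun i => 𝒜 i) →ₐ[k] (DirectSum ℕ fun i => ℬ i) := DirectSum.toAlgebra k (fun i => 𝒜 i)
    (fun i => (DirectSum.lof k ℕ (fun i => ℬ i) i).comp
      ((π.toLinearMap.restrict (hmem i))))
    (by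
      change DirectSum.of (fun i => ℬ i) 0 _ = DirectSum.of (fun i => ℬ i) 0 _
      exact congrArg _ (Subtype.ext (map_one π)))
    (by
      intro i j a b
      change DirectSum.of (fun i => ℬ i) _ _ = DirectSum.of (fun i => ℬ i) _ _ * DirectSum.of (fun i => ℬ i) _ _
      rw [DirectSum.of_mul_of]
      exact congrArg _ (Subtype.ext (map_mul π a.1 b.1)))
  let ψ : R →ₐ[k] (DirectSum ℕ fun i => ℬ i) := φ.comp (DirectSum.decomposeAlgEquiv 𝒜).toAlgHom
  have hψ : ∀ i x (hx : x ∈ 𝒜 i), ψ x = DirectSum.of (fun i => ℬ i) i (⟨π x, hmem i x hx⟩ : ℬ i) := by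
    intro i x hx
    change φ (DirectSum.decompose 𝒜 x) = _
    rw [DirectSum.decompose_of_mem 𝒜 hx]
    change DirectSum.toModule k ℕ _ _ (DirectSum.lof k ℕ (fun i => 𝒜 i) i (⟨x, hx⟩ : 𝒜 i)) = _
    rw [DirectSum.toModule_lof]
    rfl
  have hψf : ∀ x ∈ Ideal.span {f}, ψ x = 0 := by
    intro x hx
    rw [Ideal.mem_span_singleton] at hx
    obtain ⟨y, rfl⟩ := hx
    rw [map_mul, hψ d f hf]
    have : (⟨π f, hmem d f hf⟩ : ℬ d) = 0 := by
      apply Subtype.ext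
      change π f = 0
      rw [hπ, Ideal.Quotient.mkₐ_eq_mk, Ideal.Quotient.eq_zero_iff_mem]
      exact Ideal.mem_span_singleton_self f
    rw [this, map_zero, zero_mul]
  refine ⟨GradedAlgebra.ofAlgHom ℬ (Ideal.Quotient.liftₐ (Ideal.span {f}) ψ hψf) ?_ ?_⟩
  · apply AlgHom.ext
    intro b
    obtain ⟨x, rfl⟩ := Ideal.Quotient.mkₐ_surjective k _ b
    change (DirectSum.coeAlgHom ℬ) (ψ x) = π x
    induction x using DirectSum.Decomposition.inductionOn 𝒜 with
    | zero => simp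
    | homogeneous m => rw [hψ _ _ m.2, DirectSum.coeAlgHom_of]
    | add a b ha hb => rw [map_add, map_add, ha, hb, map_add]
  · rintro i ⟨_, x, hx, rfl⟩
    exact hψ i x hx

section homog

variable {k B : Type} [Field k] [CommRing B] [Algebra k B]
  (ℬ : ℕ → Submodule k B) [GradedAlgebra ℬ]

/-- projection to an integer degree -/
def cp (i : ℤ) : B →ₗ[k] B := if 0 ≤ i then GradedAlgebra.proj ℬ i.toNat else 0

theorem cp_nat (n : ℕ) (x : B) : cp ℬ n x = (DirectSum.decompose ℬ x n : B) := by
  simp [cp, GradedAlgebra.proj_apply]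

theorem cp_neg {i : ℤ} (hi : i < 0) (x : B) : cp ℬ i x = 0 := by
  simp [cp, not_le.mpr hi]

theorem cp_of_mem {n : ℕ} {x : B} (hx : x ∈ ℬ n) (i : ℤ) : cp ℬ i x = if i = n then x else 0 := by
  rcases lt_or_ge i 0 with hi | hi
  · rw [cp_neg ℬ hi, if_neg (by omega)]
  · lift i to ℕ using hi
    rw [cp_nat]
    by_cases h : i = n
    · subst h; rw [if_pos rfl, DirectSum.decompose_of_mem_same ℬ hx]
    · rw [if_neg (by exact_mod_cast h), DirectSum.decompose_of_mem_ne ℬ hx (Ne.symm h)]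

theorem cp_mul_left {n : ℕ} {a : B} (ha : a ∈ ℬ n) (i : ℤ) (x : B) :
    cp ℬ (n + i) (a * x) = a * cp ℬ i x := by
  rcases lt_or_ge i 0 with hi | hi
  · rw [cp_neg ℬ hi, mul_zero]
    rcases lt_or_ge ((n : ℤ) + i) 0 with h | h
    · exact cp_neg ℬ h _
    · obtain ⟨m, hm⟩ := Int.eq_ofNat_of_zero_le h
      rw [hm, cp_nat, DirectSum.coe_decompose_mul_of_left_mem_of_not_le ℬ ha (by omega)]
  · lift i to ℕ using hi
    rw [← Nat.cast_add, cp_nat, cp_nat, DirectSum.coe_decompose_mul_add_of_left_mem ℬ ha]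

theorem cp_mem_or (i : ℤ) (x : B) : cp ℬ i x ≠ 0 → ∃ m : ℕ, (m : ℤ) = i ∧ cp ℬ i x ∈ ℬ m := by
  intro h
  rcases lt_or_ge i 0 with hi | hi
  · exact absurd (cp_neg ℬ hi x) h
  · lift i to ℕ using hi
    exact ⟨i, rfl, by rw [cp_nat]; exact SetLike.coe_mem _⟩

theorem cp_bdd (x : B) : ∃ M : ℤ, ∀ i > M, cp ℬ i x = 0 := by
  induction x using DirectSum.Decomposition.inductionOn ℬ with
  | zero => exact ⟨0, by simp⟩
  | @homogeneous n m => exact ⟨n, fun i hi => by rw [cp_of_mem ℬ m.2, if_neg (by omega)]⟩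
  | add a b ha hb =>
    obtain ⟨M, hM⟩ := ha
    obtain ⟨N, hN⟩ := hb
    refine ⟨max M N, fun i hi => ?_⟩
    rw [map_add, hM i (by omega), hN i (by omega), add_zero]

/-- degree `j` component of a linear map -/
def hc (D : Derivation k B B) (j : ℤ) : B →ₗ[k] B :=
  (DirectSum.toModule k ℕ B (fun n => (cp ℬ (n + j)).comp
    ((D : B →ₗ[k] B).comp (ℬ n).subtype))).comp
    (DirectSum.decomposeLinearEquiv ℬ).toLinearMap

theorem hc_mem (D : Derivation k B B) (j : ℤ) {n : ℕ} {b : B} (hb : b ∈ ℬ n) :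
    hc ℬ D j b = cp ℬ (n + j) (D b) := by
  change DirectSum.toModule k ℕ B _ (DirectSum.decompose ℬ b) = _
  rw [DirectSum.decompose_of_mem ℬ hb]
  change DirectSum.toModule k ℕ B _ (DirectSum.lof k ℕ (fun i => ℬ i) n (⟨b, hb⟩ : ℬ n)) = _
  rw [DirectSum.toModule_lof]
  rfl

/-- degree `j` component of a derivation -/
def hcD (D : Derivation k B B) (j : ℤ) : Derivation k B B :=
  Derivation.mk' (hc ℬ D j) (by
    intro a b
    induction a using DirectSum.Decomposition.inductionOn ℬ with
    | zero => simp
    | add a a' ha ha' => rw [add_mul, map_add, ha, ha', map_add, add_smul, smul_add]; abel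
    | @homogeneous m a =>
      induction b using DirectSum.Decomposition.inductionOn ℬ with
      | zero => simp
      | add b b' hb hb' => rw [mul_add, map_add, hb, hb', map_add, add_smul, smul_add]; abel
      | @homogeneous n b =>
        rw [hc_mem ℬ D j (SetLike.GradedMul.mul_mem a.2 b.2), hc_mem ℬ D j a.2, hc_mem ℬ D j b.2,
          Derivation.leibniz, map_add, smul_eq_mul, smul_eq_mul, smul_eq_mul, smul_eq_mul,
          ← cp_mul_left ℬ a.2, ← cp_mul_left ℬ b.2]
        congr 2 <;> congr 1 <;> push_cast <;> ring)

theorem hcD_mem (D : Derivation k B B) (j : ℤ) {n : ℕ} {b : B} (hb : b ∈ ℬ n) :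
    hcD ℬ D j b = cp ℬ (n + j) (D b) := hc_mem ℬ D j hb

theorem hcD_bdd_elt (D : Derivation k B B) (x : B) : ∃ M : ℤ, ∀ j > M, hcD ℬ D j x = 0 := by
  induction x using DirectSum.Decomposition.inductionOn ℬ with
  | zero => exact ⟨0, by simp⟩
  | @homogeneous n m =>
    obtain ⟨M, hM⟩ := cp_bdd ℬ (D m)
    exact ⟨M, fun i hi => by rw [hcD_mem ℬ D i m.2, hM]; omega⟩
  | add a b ha hb =>
    obtain ⟨M, hM⟩ := ha
    obtain ⟨N, hN⟩ := hb
    refine ⟨max M N, fun i hi => ?_⟩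
    rw [map_add, hM i (by omega), hN i (by omega), add_zero]

theorem hcD_bdd [Algebra.FiniteType k B] (D : Derivation k B B) :
    ∃ M : ℤ, ∀ j > M, hcD ℬ D j = 0 := by
  obtain ⟨F, hF⟩ := Algebra.FiniteType.out (R := k) (A := B)
  choose M hM using hcD_bdd_elt ℬ D
  obtain ⟨N, hN⟩ : ∃ N : ℤ, ∀ x ∈ F, M x ≤ N := by
    obtain ⟨N, hN⟩ := (F.image M).bddAbove
    exact ⟨N, fun x hx => hN (by simpa using ⟨x, hx, rfl⟩)⟩
  refine ⟨N, fun j hj => Derivation.ext_of_adjoin_eq_top _ hF fun x hx => ?_⟩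
  rw [hM x j (lt_of_le_of_lt (hN x hx) hj), Derivation.zero_apply]

open scoped Classical in
theorem cp_D_sum (D : Derivation k B B) (i : ℤ) (x : B) :
    cp ℬ i (D x) = ∑ n ∈ (DirectSum.decompose ℬ x).support,
      hcD ℬ D (i - n) (DirectSum.decompose ℬ x n : B) := by
  conv_lhs => rw [← DirectSum.sum_support_decompose ℬ x]
  rw [map_sum, map_sum]
  refine Finset.sum_congr rfl fun n _ => ?_
  rw [hcD_mem ℬ D _ (SetLike.coe_mem _)]
  congr 2
  ring

theorem D_eq_zero_of_hcD (D : Derivation k B B) (h : ∀ j, hcD ℬ D j = 0) : D = 0 := by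
  classical
  ext x
  have h1 : ∀ i, cp ℬ i (D x) = 0 := fun i => by
    rw [cp_D_sum]; exact Finset.sum_eq_zero fun n _ => by rw [h]; rfl
  rw [← DirectSum.sum_support_decompose ℬ (D x)]
  exact Finset.sum_eq_zero fun n _ => by rw [← cp_nat, h1]

theorem step_hcD (D : Derivation k B B) (e : ℤ) (he : ∀ j > e, hcD ℬ D j = 0) (M : ℤ) (x : B)
    (hx : ∀ i > M, cp ℬ i x = 0) :
    (∀ i > M + e, cp ℬ i (D x) = 0) ∧ cp ℬ (M + e) (D x) = hcD ℬ D e (cp ℬ M x) := by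
  classical
  have hn : ∀ n : ℕ, (n : ℤ) > M → (DirectSum.decompose ℬ x n : B) = 0 := fun n hn => by
    rw [← cp_nat, hx _ hn]
  constructor
  · intro i hi
    rw [cp_D_sum]
    refine Finset.sum_eq_zero fun n _ => ?_
    by_cases h : (n : ℤ) > M
    · rw [hn n h, map_zero]
    · rw [he _ (by omega)]; rfl
  · rw [cp_D_sum]
    rcases lt_or_ge M 0 with hM | hM
    · rw [cp_neg ℬ hM, map_zero]
      exact Finset.sum_eq_zero fun n _ => by rw [hn n (by omega), map_zero]
    · lift M to ℕ using hM
      rw [Finset.sum_eq_single M]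
      · rw [cp_nat]; congr 2; ring
      · intro n _ hnM
        by_cases h : (n : ℤ) > M
        · rw [hn n h, map_zero]
        · rw [he _ (by omega)]; rfl
      · intro h
        rw [DFinsupp.notMem_support_iff] at h
        rw [h]; simp

theorem exists_homog_LND [Algebra.FiniteType k B] (D : Derivation k B B) (hD : IsLND D)
    (h0 : D ≠ 0) : ∃ (E : Derivation k B B) (e : ℤ), IsLND E ∧ E ≠ 0 ∧
      ∀ n b, b ∈ ℬ n → E b ≠ 0 → ∃ m : ℕ, (m : ℤ) = n + e ∧ E b ∈ ℬ m := by
  obtain ⟨N, hN⟩ := hcD_bdd ℬ D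
  have hex : ∃ j, hcD ℬ D j ≠ 0 := by
    by_contra! h
    exact h0 (D_eq_zero_of_hcD ℬ D h)
  obtain ⟨e, he0, he⟩ := Int.exists_greatest_of_bdd (P := fun j => hcD ℬ D j ≠ 0)
    ⟨N, fun j hj => by by_contra hlt; exact hj (hN j (by omega))⟩ hex
  have he' : ∀ j > e, hcD ℬ D j = 0 := fun j hj => by
    by_contra h
    have := he j h
    omega
  refine ⟨hcD ℬ D e, e, ?_, he0, ?_⟩
  · have key : ∀ (n : ℕ) (b : B), b ∈ ℬ n → ∀ m : ℕ,
        (∀ i > n + m * e, cp ℬ i ((⇑D)^[m] b) = 0) ∧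
        cp ℬ (n + m * e) ((⇑D)^[m] b) = (⇑(hcD ℬ D e))^[m] b := by
      intro n b hb m
      induction m with
      | zero =>
        refine ⟨fun i hi => ?_, ?_⟩
        · simp only [Function.iterate_zero, id]
          rw [cp_of_mem ℬ hb, if_neg]; push_cast at hi; omega
        · simp only [Function.iterate_zero, id]
          rw [cp_of_mem ℬ hb, if_pos]; push_cast; ring
      | succ m ih =>
        obtain ⟨h1, h2⟩ := step_hcD ℬ D e he' _ _ ih.1
        have : (n : ℤ) + (m + 1 : ℕ) * e = n + m * e + e := by push_cast; ring
        rw [this, Function.iterate_succ_apply', Function.iterate_succ_apply', ← ih.2]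
        exact ⟨h1, h2⟩
    intro b
    induction b using DirectSum.Decomposition.inductionOn ℬ with
    | zero => exact ⟨0, rfl⟩
    | @homogeneous n b =>
      obtain ⟨m, hm⟩ := hD b
      refine ⟨m, ?_⟩
      rw [← (key n b b.2 m).2, hm, map_zero]
    | add a b ha hb =>
      obtain ⟨m, hm⟩ := ha
      obtain ⟨m', hm'⟩ := hb
      refine ⟨m + m', ?_⟩
      rw [iterate_map_add, Function.iterate_add_apply _ m m' b, hm', add_comm m m',
        Function.iterate_add_apply _ m' m a, hm, iterate_map_zero, iterate_map_zero, add_zero]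
  · intro n b hb h
    rw [hcD_mem ℬ D e hb] at h ⊢
    exact cp_mem_or ℬ _ _ h

end homog

section core

theorem iter_mul {k B : Type} [Field k] [CommRing B] [Algebra k B] (D : Derivation k B B)
    {c : B} (hc : D c = 0) (b : B) (m : ℕ) : (⇑D)^[m] (c * b) = c * (⇑D)^[m] b := by
  induction m with
  | zero => rfl
  | succ m ih =>
    rw [Function.iterate_succ_apply', Function.iterate_succ_apply', ih, Derivation.leibniz, hc]
    simp

theorem iter_pow {k B : Type} [Field k] [CommRing B] [Algebra k B] (D : Derivation k B B)
    {s a : B} (hs : D s = a) (ha : D a = 0) (m : ℕ) :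
    (⇑D)^[m] (s ^ m) = (m.factorial : B) * a ^ m := by
  induction m with
  | zero => simp
  | succ m ih =>
    have h1 : D (s ^ (m + 1)) = ((m + 1 : ℕ) : B) * a * s ^ m := by
      rw [Derivation.leibniz_pow, hs]; simp; ring
    have h2 : D (((m + 1 : ℕ) : B) * a) = 0 := by
      rw [Derivation.leibniz, ha]; simp
    rw [Function.iterate_succ_apply, h1, iter_mul D h2, ih, Nat.factorial_succ]
    push_cast; ring

variable {k B : Type} [Field k] [CommRing B] [Algebra k B]
  (ℬ : ℕ → Submodule k B) [GradedAlgebra ℬ] (D : Derivation k B B) (e : ℤ)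

theorem iter_homog (hE : ∀ n b, b ∈ ℬ n → D b ≠ 0 → ∃ m : ℕ, (m : ℤ) = n + e ∧ D b ∈ ℬ m)
    {n : ℕ} {b : B} (hb : b ∈ ℬ n) (m : ℕ) (h : (⇑D)^[m] b ≠ 0) :
    ∃ l : ℕ, (l : ℤ) = n + m * e ∧ (⇑D)^[m] b ∈ ℬ l := by
  induction m with
  | zero => exact ⟨n, by simp, hb⟩
  | succ m ih =>
    rw [Function.iterate_succ_apply'] at h ⊢
    obtain ⟨l, hl, hl'⟩ := ih (fun h0 => h (by rw [h0, map_zero]))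
    obtain ⟨l', h1, h2⟩ := hE l _ hl' h
    exact ⟨l', by rw [h1, hl]; push_cast; ring, h2⟩

theorem reduce_step
    (hE : ∀ n b, b ∈ ℬ n → D b ≠ 0 → ∃ m : ℕ, (m : ℤ) = n + e ∧ D b ∈ ℬ m)
    {s a : B} {d p : ℕ} (hs : s ∈ ℬ d) (ha : a ∈ ℬ p) (hsa : D s = a) (hDa : D a = 0)
    (hp : (p : ℤ) = d + e) {n : ℕ} {b : B} (hb : b ∈ ℬ n) (m : ℕ) (h : (⇑D)^[m + 1] b = 0) :
    ∃ b' c : B, D c = 0 ∧ (c ≠ 0 → ∃ l : ℕ, c ∈ ℬ l ∧ l + m * d = n + m * p) ∧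
      b' ∈ ℬ (n + m * p) ∧ (⇑D)^[m] b' = 0 ∧ (m.factorial : B) * a ^ m * b = b' + c * s ^ m := by
  have hDc : D ((⇑D)^[m] b) = 0 := by rw [Function.iterate_succ_apply'] at h; exact h
  have hDf : D ((m.factorial : B) * a ^ m) = 0 := by
    rw [Derivation.leibniz, Derivation.leibniz_pow, hDa]; simp
  have hl : (⇑D)^[m] b ≠ 0 → ∃ l : ℕ, (⇑D)^[m] b ∈ ℬ l ∧ l + m * d = n + m * p := by
    intro h0
    obtain ⟨l, h1, h2⟩ := iter_homog ℬ D e hE hb m h0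
    refine ⟨l, h2, ?_⟩
    zify
    rw [h1, hp]; ring
  refine ⟨(m.factorial : B) * a ^ m * b - (⇑D)^[m] b * s ^ m, (⇑D)^[m] b, hDc, hl, ?_, ?_, by ring⟩
  · refine Submodule.sub_mem _ ?_ ?_
    · rw [mul_assoc, ← nsmul_eq_mul]
      refine Submodule.smul_of_tower_mem _ _ ?_
      rw [add_comm]
      have := SetLike.pow_mem_graded m ha
      exact SetLike.mul_mem_graded (by simpa using this) hb
    · by_cases h0 : (⇑D)^[m] b = 0
      · rw [h0, zero_mul]; exact zero_mem _
      · obtain ⟨l, h1, h2⟩ := hl h0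
        rw [← h2]
        have := SetLike.pow_mem_graded m hs
        exact SetLike.mul_mem_graded h1 (by simpa using this)
  · rw [iterate_map_sub, iter_mul D hDf, iter_mul D hDc, iter_pow D hsa hDa]
    ring

theorem exists_slice (hD : IsLND D) (h0 : D ≠ 0)
    (hE : ∀ n b, b ∈ ℬ n → D b ≠ 0 → ∃ m : ℕ, (m : ℤ) = n + e ∧ D b ∈ ℬ m) :
    ∃ (s a : B) (d p : ℕ), s ∈ ℬ d ∧ a ∈ ℬ p ∧ D s = a ∧ D a = 0 ∧ a ≠ 0 ∧ (p : ℤ) = d + e := by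
  obtain ⟨n, b, hb, hDb⟩ : ∃ n b, b ∈ ℬ n ∧ D b ≠ 0 := by
    by_contra! h
    apply h0
    ext x
    induction x using DirectSum.Decomposition.inductionOn ℬ with
    | zero => simp
    | @homogeneous n b => exact h n b b.2
    | add x y hx hy => rw [map_add, hx, hy]; simp
  classical
  obtain ⟨m, hm, hmin⟩ : ∃ m, (⇑D)^[m] b = 0 ∧ ∀ j < m, (⇑D)^[j] b ≠ 0 :=
    ⟨Nat.find (hD b), Nat.find_spec (hD b), fun j hj => Nat.find_min (hD b) hj⟩
  match m, hm, hmin with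
  | 0, hm, _ => exact absurd (by rw [show b = 0 from hm, map_zero]) hDb
  | 1, hm, _ => exact absurd hm hDb
  | m + 2, hm, hmin =>
    have ha0 := hmin (m + 1) (by omega)
    obtain ⟨d, hd, hs⟩ := iter_homog ℬ D e hE hb m (hmin m (by omega))
    rw [Function.iterate_succ_apply'] at ha0
    obtain ⟨p, hp, ha⟩ := hE d _ hs ha0
    refine ⟨(⇑D)^[m] b, _, d, p, hs, ha, rfl, ?_, ha0, hp⟩
    rw [Function.iterate_succ_apply', Function.iterate_succ_apply'] at hm; exact hm

theorem exists_pos_ker [CharZero k] [IsDomain B] (hD : IsLND D)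
    (hB0 : ℬ 0 = Submodule.span k {(1 : B)})
    (hE : ∀ n b, b ∈ ℬ n → D b ≠ 0 → ∃ m : ℕ, (m : ℤ) = n + e ∧ D b ∈ ℬ m)
    {s a : B} {d p : ℕ} (hs : s ∈ ℬ d) (ha : a ∈ ℬ p) (hsa : D s = a) (hDa : D a = 0)
    (ha0 : a ≠ 0) (hp : (p : ℤ) = d + e)
    (H : ¬ ∃ (s : B) (d : ℕ), s ∈ ℬ d ∧ Algebra.adjoin k {s} = ⊤) :
    ∃ (h : B) (n : ℕ), 0 < n ∧ h ∈ ℬ n ∧ h ≠ 0 ∧ D h = 0 := by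
  by_contra! hcon
  apply H
  refine ⟨s, d, hs, ?_⟩
  have hk : ∀ c l, c ∈ ℬ l → D c = 0 → ∃ x : k, c = algebraMap k B x := by
    intro c l hc hDc
    by_cases h0 : c = 0
    · exact ⟨0, by simp [h0]⟩
    rcases Nat.eq_zero_or_pos l with rfl | hl
    · rw [hB0, Submodule.mem_span_singleton] at hc
      obtain ⟨x, rfl⟩ := hc
      exact ⟨x, Algebra.smul_def x 1 |>.trans (by simp)⟩
    · exact absurd hDc (hcon c l hl hc h0)
  have hmain : ∀ m n b, b ∈ ℬ n → (⇑D)^[m] b = 0 → b ∈ Algebra.adjoin k {s} := by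
    intro m
    induction m with
    | zero => intro n b _ hb; rw [show b = 0 from hb]; exact zero_mem _
    | succ m ih =>
      intro n b hb h
      obtain ⟨b', c, hDc, hl, hb', hDb', heq⟩ := reduce_step ℬ D e hE hs ha hsa hDa hp hb m h
      have h1 := ih _ _ hb' hDb'
      have h2 : c ∈ Algebra.adjoin k {s} := by
        by_cases h0 : c = 0
        · rw [h0]; exact zero_mem _
        · obtain ⟨l, hl, _⟩ := hl h0
          obtain ⟨x, rfl⟩ := hk c l hl hDc
          exact Subalgebra.algebraMap_mem _ _
      obtain ⟨x, rfl⟩ := hk a p ha hDa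
      have hx : (m.factorial : k) * x ^ m ≠ 0 :=
        mul_ne_zero (by exact_mod_cast m.factorial_ne_zero) (pow_ne_zero _ (by
          rintro rfl; simp at ha0))
      have h3 : ((m.factorial : k) * x ^ m) • b ∈ Algebra.adjoin k {s} := by
        rw [Algebra.smul_def, map_mul, map_natCast, map_pow, heq]
        exact add_mem h1 (mul_mem h2 (pow_mem (Algebra.self_mem_adjoin_singleton k s) _))
      have := Subalgebra.smul_mem _ h3 ((m.factorial : k) * x ^ m)⁻¹
      rwa [inv_smul_smul₀ hx] at this
  rw [eq_top_iff]
  rintro b -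
  induction b using DirectSum.Decomposition.inductionOn ℬ with
  | zero => exact zero_mem _
  | @homogeneous n b =>
    obtain ⟨m, hm⟩ := hD b
    exact hmain m n b b.2 hm
  | add x y hx hy => exact add_mem hx hy

end core

section factP

theorem mem_range_of_alg {k K : Type} [Field k] [IsAlgClosed k] [Field K] [Algebra k K] (t : K)
    (h : IsAlgebraic k t) : ∃ x : k, algebraMap k K x = t :=
  minpoly.mem_range_of_degree_eq_one k t
    (IsAlgClosed.degree_eq_one_of_irreducible k (minpoly.irreducible h.isIntegral))

variable {k B : Type} [Field k] [CharZero k] [CommRing B] [IsDomain B] [Algebra k B]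

theorem trans_slice (D : Derivation k B B) {s a : B} (hsa : D s = a) (ha0 : a ≠ 0)
    (S : Subalgebra k B) (hS : ∀ x ∈ S, D x = 0) : Transcendental S s := by
  have hder : ∀ P : Polynomial S,
      D (Polynomial.aeval s P) = Polynomial.aeval s (Polynomial.derivative P) * a := by
    intro P
    induction P using Polynomial.induction_on' with
    | add p q hp hq => simp only [map_add, hp, hq]; ring
    | monomial n c =>
      rw [Polynomial.aeval_monomial, Polynomial.derivative_monomial, Polynomial.aeval_monomial,
        Derivation.leibniz, Derivation.leibniz_pow, hsa]
      have : D (algebraMap S B c) = 0 := hS _ c.2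
      rw [this]
      simp
      ring
  have : CharZero B := charZero_of_injective_algebraMap (algebraMap k B).injective
  rw [transcendental_iff]
  intro P
  induction hn : P.natDegree using Nat.strong_induction_on generalizing P with
  | _ n ih =>
    intro hP
    have hP0 : P.natDegree = 0 := by
      by_contra hne
      have h1 : Polynomial.aeval s (Polynomial.derivative P) = 0 := by
        have := hder P
        rw [hP, map_zero] at this
        exact (mul_eq_zero.mp this.symm).resolve_right ha0
      have h2 := ih _ (hn ▸ Polynomial.natDegree_derivative_lt hne) _ rfl h1
      exact hne (Polynomial.derivative_eq_zero.mp h2)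
    rw [Polynomial.eq_C_of_natDegree_eq_zero hP0] at hP ⊢
    rw [Polynomial.aeval_C] at hP
    rw [show P.coeff 0 = 0 from Subtype.ext hP, map_zero]

theorem not_indep (htr : Algebra.trdeg k B ≤ 2) (D : Derivation k B B) {s a x y : B}
    (hsa : D s = a) (ha0 : a ≠ 0) (hx : D x = 0) (hy : D y = 0) :
    ¬ AlgebraicIndependent k ![x, y] := by
  intro h
  have h1 := (h.option_iff_transcendental s).mpr (trans_slice D hsa ha0 _ (by
    intro z hz
    induction hz using Algebra.adjoin_induction with
    | mem z hz =>
      obtain ⟨i, rfl⟩ := hz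
      fin_cases i
      · exact hx
      · exact hy
    | algebraMap r => exact D.map_algebraMap r
    | add u v _ _ hu hv => rw [map_add, hu, hv, add_zero]
    | mul u v _ _ hu hv => rw [Derivation.leibniz, hu, hv]; simp))
  have h2 := h1.cardinalMk_le_trdeg.trans htr
  simp at h2
  norm_num at h2

theorem homog_scale {σ S : Type} [CommRing S] [Algebra k S] {q : MvPolynomial σ k} {m : ℕ}
    (hq : q.IsHomogeneous m) (u : S) (g : σ → S) :
    aeval (fun i => u * g i) q = u ^ m * aeval g q := by
  rw [aeval_def, aeval_def, eval₂_eq, eval₂_eq, Finset.mul_sum]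
  refine Finset.sum_congr rfl fun d hd => ?_
  simp only [mul_pow]
  rw [Finset.prod_mul_distrib, Finset.prod_pow_eq_pow_sum, hq.degree_eq_sum_deg_support hd]
  ring

theorem homog_aeval_mem (ℬ : ℕ → Submodule k B) [GradedAlgebra ℬ] {n m : ℕ} {q : MvPolynomial (Fin 2) k}
    (hq : q.IsHomogeneous m) {x y : B} (hx : x ∈ ℬ n) (hy : y ∈ ℬ n) :
    aeval ![x, y] q ∈ ℬ (m * n) := by
  rw [aeval_def, eval₂_eq']
  refine Submodule.sum_mem _ fun d hd => ?_
  rw [← Algebra.smul_def]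
  refine Submodule.smul_mem _ _ ?_
  have := hq.degree_eq_sum_deg_support hd
  rw [this, Finset.sum_subset (Finset.subset_univ _) (fun i _ hi => by simpa using hi)]
  simp only [Fin.prod_univ_two, Fin.sum_univ_two]
  rw [add_mul]
  have h1 := SetLike.pow_mem_graded (d 0) hx
  have h2 := SetLike.pow_mem_graded (d 1) hy
  exact SetLike.mul_mem_graded (by simpa using h1) (by simpa using h2)

theorem factP [IsAlgClosed k] (ℬ : ℕ → Submodule k B) [GradedAlgebra ℬ]
    (hB0 : ℬ 0 = Submodule.span k {(1 : B)}) (htr : Algebra.trdeg k B ≤ 2)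
    (D : Derivation k B B) {s a x y : B} {n : ℕ}
    (hsa : D s = a) (ha0 : a ≠ 0) (hx : D x = 0) (hy : D y = 0) (hxn : x ∈ ℬ n) (hyn : y ∈ ℬ n)
    (hx0 : x ≠ 0) : ∃ c : k, y = c • x := by
  rcases Nat.eq_zero_or_pos n with rfl | hn
  · rw [hB0, Submodule.mem_span_singleton] at hxn hyn
    obtain ⟨u, rfl⟩ := hxn
    obtain ⟨v, rfl⟩ := hyn
    have : u ≠ 0 := by rintro rfl; simp at hx0
    exact ⟨v / u, by rw [smul_smul, div_mul_cancel₀ _ this]⟩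
  have hdep := not_indep htr D hsa ha0 hx hy
  rw [algebraicIndependent_iff] at hdep
  push Not at hdep
  obtain ⟨q, hq, hq0⟩ := hdep
  obtain ⟨m, hm⟩ : ∃ m, homogeneousComponent m q ≠ 0 := by
    by_contra! h
    apply hq0
    rw [← sum_homogeneousComponent q]
    exact Finset.sum_eq_zero fun i _ => h i
  have hqm : aeval ![x, y] (homogeneousComponent m q) = 0 := by
    have hmem : ∀ i, aeval ![x, y] (homogeneousComponent i q) ∈ ℬ (i * n) := fun i =>
      homog_aeval_mem ℬ (homogeneousComponent_isHomogeneous i q) hxn hyn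
    have h1 : cp ℬ ((m * n : ℕ) : ℤ) (aeval ![x, y] q) =
        aeval ![x, y] (homogeneousComponent m q) := by
      conv_lhs => rw [← sum_homogeneousComponent q]
      rw [map_sum, map_sum, Finset.sum_eq_single m]
      · rw [cp_of_mem ℬ (hmem m), if_pos rfl]
      · intro i _ him
        rw [cp_of_mem ℬ (hmem i), if_neg]
        intro h
        exact him (Nat.eq_of_mul_eq_mul_right hn (by exact_mod_cast h.symm))
      · intro h
        rw [homogeneousComponent_eq_zero _ _ (by simpa using h), map_zero, map_zero]
    rw [← h1, hq, map_zero]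
  set Q := homogeneousComponent m q
  have hQ : Q.IsHomogeneous m := homogeneousComponent_isHomogeneous m q
  let K := FractionRing B
  have hinj : Function.Injective (algebraMap B K) := IsFractionRing.injective B K
  have hxK : algebraMap B K x ≠ 0 := by simpa using hx0
  set t : K := algebraMap B K y / algebraMap B K x with ht
  have hP1 : ∀ (S : Type) [CommRing S] [Algebra k S] (z : S),
      Polynomial.aeval z (aeval ![1, Polynomial.X] Q : Polynomial k) = aeval ![1, z] Q := by
    intro S _ _ z
    rw [MvPolynomial.comp_aeval_apply]
    congr 2
    ext i; fin_cases i <;> simp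
  have hP0 : (aeval ![1, Polynomial.X] Q : Polynomial k) ≠ 0 := by
    intro h0
    have : X 0 * Q = 0 := by
      apply MvPolynomial.funext
      intro w
      rw [map_mul, map_zero, eval_X]
      by_cases hw : w 0 = 0
      · rw [hw, zero_mul]
      · have h2 := homog_scale hQ (w 0) ![1, w 1 / w 0]
        rw [← hP1 k (w 1 / w 0), h0, map_zero, mul_zero] at h2
        have h3 : (fun i => w 0 * (![1, w 1 / w 0] : Fin 2 → k) i) = w := by
          ext i; fin_cases i
          · simp
          · simp; field_simp
        rw [h3, aeval_eq_eval] at h2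
        rw [show eval w Q = 0 from h2, mul_zero]
    rcases mul_eq_zero.mp this with h | h
    · exact X_ne_zero _ h
    · exact hm h
  have halg : IsAlgebraic k t := by
    refine ⟨_, hP0, ?_⟩
    rw [hP1]
    have h2 := homog_scale hQ (algebraMap B K x) ![1, t]
    have h3 : (fun i => algebraMap B K x * (![1, t] : Fin 2 → K) i) =
        fun i => algebraMap B K (![x, y] i) := by
      ext i; fin_cases i
      · simp
      · change algebraMap B K x * t = algebraMap B K y
        rw [ht, mul_comm, div_mul_cancel₀ _ hxK]
    have h4 : aeval (fun i => algebraMap B K (![x, y] i)) Q = algebraMap B K (aeval ![x, y] Q) :=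
      MvPolynomial.aeval_algebraMap_apply K _ Q
    rw [h3, h4, hqm, map_zero] at h2
    exact (mul_eq_zero.mp h2.symm).resolve_left (pow_ne_zero _ hxK)
  obtain ⟨c, hc⟩ := mem_range_of_alg t halg
  refine ⟨c, hinj ?_⟩
  rw [Algebra.smul_def, map_mul, ← IsScalarTower.algebraMap_apply k B K, hc, ht,
    div_mul_cancel₀ _ hxK]

end factP

section final

variable {k B : Type} [Field k] [CharZero k] [IsAlgClosed k] [CommRing B] [IsDomain B] [Algebra k B]

theorem core_adjoin (ℬ : ℕ → Submodule k B) [GradedAlgebra ℬ]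
    (hB0 : ℬ 0 = Submodule.span k {(1 : B)}) (htr : Algebra.trdeg k B ≤ 2)
    (D : Derivation k B B) (e : ℤ) (hD : IsLND D)
    (hE : ∀ n b, b ∈ ℬ n → D b ≠ 0 → ∃ m : ℕ, (m : ℤ) = n + e ∧ D b ∈ ℬ m)
    {s a : B} {d p : ℕ} (hs : s ∈ ℬ d) (ha : a ∈ ℬ p) (hsa : D s = a) (hDa : D a = 0)
    (ha0 : a ≠ 0) (hp : (p : ℤ) = d + e) (hp0 : 0 < p) :
    ∃ (τ : FractionRing B) (w : B) (N : ℕ), w ∈ ℬ (N * p) ∧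
      τ = algebraMap B _ w / algebraMap B _ a ^ N ∧ Transcendental k τ ∧
      ∀ n b, b ∈ ℬ (n * p) →
        algebraMap B (FractionRing B) b / algebraMap B _ a ^ n ∈ Algebra.adjoin k {τ} := by
  classical
  let K := FractionRing B
  have hinj : Function.Injective (algebraMap B K) := IsFractionRing.injective B K
  have haK : algebraMap B K a ≠ 0 := by simpa using ha0
  have hs0 : s ≠ 0 := by rintro rfl; rw [map_zero] at hsa; exact ha0 hsa.symm
  have hpow : ∀ {x : B} {n : ℕ}, x ∈ ℬ n → ∀ i : ℕ, x ^ i ∈ ℬ (i * n) := fun hx i => by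
    simpa using SetLike.pow_mem_graded i hx
  have hDpow : ∀ {x : B}, D x = 0 → ∀ i : ℕ, D (x ^ i) = 0 := fun hx i => by
    rw [Derivation.leibniz_pow, hx]; simp
  have hDmul : ∀ {x y : B}, D x = 0 → D y = 0 → D (x * y) = 0 := fun hx hy => by
    rw [Derivation.leibniz, hx, hy]; simp
  have hM : ∃ q, 0 < q ∧ ∃ (c : B) (l N : ℕ), c ≠ 0 ∧ D c = 0 ∧ c ∈ ℬ l ∧ l + q * d = N * p :=
    ⟨p, hp0, 1, 0, d, one_ne_zero, by simp, SetLike.one_mem_graded ℬ, by ring⟩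
  obtain ⟨q, ⟨hq0, c0, l0, N0, hc0, hDc0, hc0l, hl0⟩, hqmin⟩ : ∃ q, (0 < q ∧ ∃ (c : B) (l N : ℕ),
      c ≠ 0 ∧ D c = 0 ∧ c ∈ ℬ l ∧ l + q * d = N * p) ∧ ∀ i < q, ¬ (0 < i ∧ ∃ (c : B) (l N : ℕ),
      c ≠ 0 ∧ D c = 0 ∧ c ∈ ℬ l ∧ l + i * d = N * p) :=
    ⟨Nat.find hM, Nat.find_spec hM, fun i hi => Nat.find_min hM hi⟩
  set τ : K := algebraMap B K (c0 * s ^ q) / algebraMap B K a ^ N0 with hτ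
  have hτmem : τ ∈ Algebra.adjoin k {τ} := Algebra.self_mem_adjoin_singleton k τ
  have hw : c0 * s ^ q ∈ ℬ (N0 * p) := by
    rw [← hl0]; exact SetLike.mul_mem_graded hc0l (hpow hs q)
  refine ⟨τ, c0 * s ^ q, N0, hw, rfl, ?_, ?_⟩
  · intro halg
    obtain ⟨x, hx⟩ := mem_range_of_alg τ halg
    rw [hτ, eq_div_iff (pow_ne_zero _ haK), IsScalarTower.algebraMap_apply k B K, ← map_pow,
      ← map_mul] at hx
    have h1 := congrArg D (hinj hx)
    rw [← Algebra.smul_def, D.map_smul, hDpow hDa, smul_zero, Derivation.leibniz, hDc0,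
      Derivation.leibniz_pow, hsa] at h1
    have : CharZero B := charZero_of_injective_algebraMap (algebraMap k B).injective
    simp only [smul_eq_mul, nsmul_eq_mul, mul_zero, add_zero] at h1
    have h2 : (q : B) ≠ 0 := by exact_mod_cast hq0.ne'
    exact (mul_ne_zero hc0 (mul_ne_zero h2 (mul_ne_zero (pow_ne_zero _ hs0) ha0))) h1.symm
  obtain ⟨lam, hlam⟩ := factP ℬ hB0 htr D hsa ha0 (hDpow hDa l0) (hDpow hDc0 p) (hpow ha l0)
    (by rw [mul_comm]; exact hpow hc0l p) (pow_ne_zero _ ha0)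
  have hlam0 : lam ≠ 0 := by
    rintro rfl
    rw [zero_smul] at hlam
    exact pow_ne_zero _ hc0 hlam
  have claim : ∀ i (c : B) (l N : ℕ), D c = 0 → c ∈ ℬ l → l + i * d = N * p →
      algebraMap B K (c * s ^ i) / algebraMap B K a ^ N ∈ Algebra.adjoin k {τ} := by
    intro i
    induction i using Nat.strong_induction_on with
    | _ i ih =>
      intro c l N hDc hcl hl
      by_cases hc : c = 0
      · rw [hc]; simp
      rcases Nat.eq_zero_or_pos i with rfl | hi
      · obtain ⟨x, hx⟩ := factP ℬ hB0 htr D hsa ha0 (hDpow hDa N) hDc (hpow ha N)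
          (by rw [← hl]; simpa using hcl) (pow_ne_zero _ ha0)
        have : algebraMap B K (c * s ^ 0) / algebraMap B K a ^ N = algebraMap k K x := by
          rw [pow_zero, mul_one, hx, Algebra.smul_def, map_mul, map_pow,
            ← IsScalarTower.algebraMap_apply k B K, mul_div_cancel_right₀ _ (pow_ne_zero _ haK)]
        rw [this]
        exact Subalgebra.algebraMap_mem _ _
      have hqi : q ≤ i := by
        by_contra hlt
        exact hqmin i (by omega) ⟨hi, c, l, N, hc, hDc, hcl, hl⟩
      obtain ⟨r, rfl⟩ := Nat.exists_eq_add_of_le hqi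
      obtain ⟨p', rfl⟩ : ∃ p', p = p' + 1 := ⟨p - 1, by omega⟩
      have hdeg : l + p' * l0 + r * d + N0 * (p' + 1) = (N + l0) * (p' + 1) := by
        rw [← hl0, add_mul, ← hl]; ring
      obtain ⟨N', hN'⟩ : ∃ N', N + l0 = N' + N0 := by
        have : N0 ≤ N + l0 := Nat.le_of_mul_le_mul_right
          (show N0 * (p' + 1) ≤ (N + l0) * (p' + 1) by omega) (by omega)
        exact ⟨N + l0 - N0, by omega⟩
      have h1 := ih r (by omega) (c * c0 ^ p') (l + p' * l0) N' (hDmul hDc (hDpow hDc0 _))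
        (SetLike.mul_mem_graded hcl (hpow hc0l p')) (by
          rw [hN', add_mul] at hdeg; omega)
      have h2 := Subalgebra.smul_mem _ (mul_mem h1 hτmem) lam⁻¹
      convert h2 using 1
      have h3 : algebraMap B K c0 ^ (p' + 1) = algebraMap k K lam * algebraMap B K a ^ l0 := by
        rw [← map_pow, hlam, Algebra.smul_def, map_mul, map_pow,
          ← IsScalarTower.algebraMap_apply k B K]
      have hlamK : algebraMap k K lam ≠ 0 := by simpa using hlam0
      have h4 : algebraMap B K a ^ N * algebraMap B K a ^ l0 =
          algebraMap B K a ^ N' * algebraMap B K a ^ N0 := by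
        rw [← pow_add, ← pow_add, hN']
      rw [Algebra.smul_def, map_inv₀, hτ, div_mul_div_comm, ← h4]
      rw [eq_comm, inv_mul_eq_div, div_div, div_eq_div_iff (by positivity) (by positivity)]
      simp only [map_mul, map_pow]
      linear_combination (algebraMap B K c * algebraMap B K s ^ (q + r) * algebraMap B K a ^ N) * h3
  have hmain : ∀ m n b, b ∈ ℬ (n * p) → (⇑D)^[m] b = 0 →
      algebraMap B K b / algebraMap B K a ^ n ∈ Algebra.adjoin k {τ} := by
    intro m
    induction m with
    | zero => intro n b _ hb; rw [show b = 0 from hb]; simp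
    | succ m ih =>
      intro n b hb h
      obtain ⟨b', c, hDc, hl, hb', hDb', heq⟩ := reduce_step ℬ D e hE hs ha hsa hDa hp hb m h
      rw [← add_mul] at hb' hl
      have h1 := ih _ _ hb' hDb'
      have h2 : algebraMap B K (c * s ^ m) / algebraMap B K a ^ (n + m) ∈ Algebra.adjoin k {τ} := by
        by_cases h0 : c = 0
        · rw [h0]; simp
        · obtain ⟨l, hcl, hl⟩ := hl h0
          exact claim m c l _ hDc hcl hl
      have hmk : (m.factorial : k) ≠ 0 := by exact_mod_cast m.factorial_ne_zero
      have hmK : (m.factorial : K) ≠ 0 := by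
        rw [← map_natCast (algebraMap k K)]; exact (map_ne_zero _).mpr hmk
      have h3 := Subalgebra.smul_mem _ (add_mem h1 h2) (m.factorial : k)⁻¹
      convert h3 using 1
      rw [← add_div, ← map_add, ← heq, Algebra.smul_def, map_inv₀, map_natCast, map_mul, map_mul,
        map_natCast, map_pow, pow_add]
      rw [eq_comm, inv_mul_eq_div, div_div, div_eq_div_iff
        (mul_ne_zero (mul_ne_zero (pow_ne_zero _ haK) (pow_ne_zero _ haK)) hmK)
        (pow_ne_zero _ haK)]
      ring
  intro n b hb
  obtain ⟨m, hm⟩ := hD b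
  exact hmain m n b hb hm

theorem core_iso (ℬ : ℕ → Submodule k B) [GradedAlgebra ℬ]
    {a : B} {p : ℕ} (ha : a ∈ ℬ p) (ha0 : a ≠ 0)
    (τ : FractionRing B) (w : B) (N : ℕ) (hw : w ∈ ℬ (N * p))
    (hτ : τ = algebraMap B _ w / algebraMap B _ a ^ N) (htr : Transcendental k τ)
    (hall : ∀ n b, b ∈ ℬ (n * p) →
        algebraMap B (FractionRing B) b / algebraMap B _ a ^ n ∈ Algebra.adjoin k {τ}) :
    Nonempty (HomogeneousLocalization.Away ℬ a ≃+* Polynomial k) := by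
  let K := FractionRing B
  have hinj : Function.Injective (algebraMap B K) := IsFractionRing.injective B K
  have haK : algebraMap B K a ≠ 0 := by simpa using ha0
  let φ : Localization.Away a →+* K := Localization.awayLift (algebraMap B K) a haK.isUnit
  have hφ : ∀ b n, φ (Localization.mk b ⟨a ^ n, n, rfl⟩) = algebraMap B K b / algebraMap B K a ^ n := by
    intro b n
    have h1 := Localization.awayLift_mk (algebraMap B K) a b (algebraMap B K a)⁻¹
      (mul_inv_cancel₀ haK) n
    rw [div_eq_mul_inv, ← inv_pow]
    exact h1
  have hφi : Function.Injective φ := by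
    rw [injective_iff_map_eq_zero]
    intro z
    induction z using Localization.induction_on with
    | H z =>
      obtain ⟨b, ⟨_, n, rfl⟩⟩ := z
      intro hz
      have h1 := hφ b n
      rw [show φ (Localization.mk b ⟨a ^ n, n, rfl⟩) = 0 from hz, eq_comm, div_eq_zero_iff] at h1
      have : b = 0 := by
        rcases h1 with h | h
        · exact hinj (by rw [h, map_zero])
        · exact absurd h (pow_ne_zero _ haK)
      simp only [this]
      exact Localization.mk_zero _
  let g : HomogeneousLocalization.Away ℬ a →+* K :=
    φ.comp (algebraMap (HomogeneousLocalization.Away ℬ a) (Localization.Away a))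
  have hgi : Function.Injective g := hφi.comp (HomogeneousLocalization.val_injective _)
  have hg : ∀ n b (hb : b ∈ ℬ (n • p)), g (HomogeneousLocalization.Away.mk ℬ ha n b hb) =
      algebraMap B K b / algebraMap B K a ^ n := by
    intro n b hb
    change φ (HomogeneousLocalization.Away.mk ℬ ha n b hb).val = _
    rw [HomogeneousLocalization.Away.val_mk, hφ]
  let ψ : Polynomial k →+* K := (Polynomial.aeval (R := k) τ).toRingHom
  have hψi : Function.Injective ψ := transcendental_iff_injective.mp htr
  have hr : g.range = ψ.range := by
    apply le_antisymm
    · rintro _ ⟨z, rfl⟩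
      obtain ⟨n, b, hb, rfl⟩ := HomogeneousLocalization.Away.mk_surjective ℬ ha z
      rw [hg]
      have := hall n b hb
      rw [Algebra.adjoin_singleton_eq_range_aeval] at this
      exact this
    · rintro _ ⟨P, rfl⟩
      change Polynomial.aeval τ P ∈ g.range
      induction P using Polynomial.induction_on' with
      | add P Q hP hQ => rw [map_add]; exact add_mem hP hQ
      | monomial n c =>
        rw [Polynomial.aeval_monomial]
        refine mul_mem ?_ (pow_mem ?_ n)
        · refine ⟨HomogeneousLocalization.Away.mk ℬ ha 0 (algebraMap k B c) ?_, ?_⟩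
          · rw [zero_smul]; exact SetLike.algebraMap_mem_graded ℬ c
          · rw [hg, pow_zero, div_one, ← IsScalarTower.algebraMap_apply]
        · exact ⟨HomogeneousLocalization.Away.mk ℬ ha N w hw, by rw [hg, hτ]⟩
  let e1 : HomogeneousLocalization.Away ℬ a ≃+* g.range :=
    RingEquiv.ofBijective g.rangeRestrict
      ⟨fun x y h => hgi (congrArg Subtype.val h), g.rangeRestrict_surjective⟩
  let e2 : Polynomial k ≃+* ψ.range :=
    RingEquiv.ofBijective ψ.rangeRestrict
      ⟨fun x y h => hψi (congrArg Subtype.val h), ψ.rangeRestrict_surjective⟩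
  exact ⟨(e1.trans (RingEquiv.subringCongr hr)).trans e2.symm⟩

theorem aux_b_to_c [Algebra.FiniteType k B] (ℬ : ℕ → Submodule k B) [GradedAlgebra ℬ]
    (hB0 : ℬ 0 = Submodule.span k {(1 : B)}) (htr : Algebra.trdeg k B ≤ 2)
    (H : ¬ ∃ (s : B) (d : ℕ), s ∈ ℬ d ∧ Algebra.adjoin k {s} = ⊤)
    (hrig : ¬ IsRigid k B) : ProjContainsAffineLine k ℬ := by
  unfold IsRigid at hrig
  push Not at hrig
  obtain ⟨D', hD', hD'0⟩ := hrig
  obtain ⟨D, e, hD, hD0, hE⟩ := exists_homog_LND ℬ D' hD' hD'0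
  obtain ⟨s, a, d, p, hs, ha, hsa, hDa, ha0, hp⟩ := exists_slice ℬ D e hD hD0 hE
  obtain ⟨h, n, hn, hh, hh0, hDh⟩ := exists_pos_ker ℬ D e hD hB0 hE hs ha hsa hDa ha0 hp H
  have ha' : a * h ∈ ℬ (p + n) := SetLike.mul_mem_graded ha hh
  have ha0' : a * h ≠ 0 := mul_ne_zero ha0 hh0
  obtain ⟨τ, w, N, hw, hτ, htrτ, hall⟩ := core_adjoin ℬ hB0 htr D e hD hE
    (s := s * h) (a := a * h) (d := d + n) (p := p + n)
    (SetLike.mul_mem_graded hs hh) ha'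
    (by rw [Derivation.leibniz, hsa, hDh]; simp; ring)
    (by rw [Derivation.leibniz, hDa, hDh]; simp) ha0' (by push_cast; omega) (by omega)
  obtain ⟨E⟩ := core_iso ℬ ha' ha0' τ w N hw hτ htrτ hall
  refine ⟨AlgebraicGeometry.Proj.basicOpen ℬ (a * h), ⟨?_⟩⟩
  exact (AlgebraicGeometry.Proj.basicOpenIsoSpec ℬ (a * h) ha' (by omega)).trans
    (AlgebraicGeometry.Scheme.Spec.mapIso (RingEquiv.toCommRingCatIso E.symm).op)

end final

section lifting

theorem not_adjoin_one (k R : Type) [Field k] [CommRing R] [IsDomain R] [Algebra k R]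
    (hdim : ringKrullDim R = 3) (f : R) (hf : Prime f) (𝒜 : ℕ → Submodule k R) [GradedAlgebra 𝒜]
    (δ : ℕ) (hfδ : f ∈ 𝒜 δ) (h0 : 𝒜 0 = Submodule.span k {(1 : R)}) :
    ¬ ∃ (s : R ⧸ Ideal.span {f}) (d : ℕ),
      s ∈ (𝒜 d).map (Ideal.Quotient.mkₐ k (Ideal.span {f})).toLinearMap ∧
      Algebra.adjoin k {s} = ⊤ := by
  rintro ⟨_, d, ⟨s, hs, rfl⟩, htop⟩
  have hδ : 0 < δ := by
    rcases Nat.eq_zero_or_pos δ with rfl | h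
    · exfalso
      rw [h0, Submodule.mem_span_singleton] at hfδ
      obtain ⟨c, rfl⟩ := hfδ
      by_cases hc : c = 0
      · rw [hc, zero_smul] at hf; exact hf.ne_zero rfl
      · apply hf.not_isUnit
        rw [← Algebra.algebraMap_eq_smul_one]
        exact (IsUnit.mk0 c hc).map _
    · exact h
  have key : ∀ n, ∀ r ∈ 𝒜 n, r ∈ Algebra.adjoin k {f, s} := by
    intro n
    induction n using Nat.strong_induction_on with
    | _ n ih =>
      intro r hr
      have h1 : Ideal.Quotient.mkₐ k (Ideal.span {f}) r ∈
          Algebra.adjoin k {(Ideal.Quotient.mkₐ k (Ideal.span {f})).toLinearMap s} := by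
        rw [htop]; trivial
      rw [Algebra.adjoin_singleton_eq_range_aeval] at h1
      obtain ⟨P, hP⟩ := h1
      have hP' : Ideal.Quotient.mkₐ k (Ideal.span {f}) (Polynomial.aeval s P) =
          Ideal.Quotient.mkₐ k (Ideal.span {f}) r := by
        rw [← hP, ← Polynomial.aeval_algHom_apply]; rfl
      obtain ⟨t, ht⟩ := Ideal.mem_span_singleton'.mp (Ideal.Quotient.eq.mp hP')
      have hrt : r = Polynomial.aeval s P - f * t := by rw [mul_comm, ht]; ring
      have h2 : r = cp 𝒜 n (Polynomial.aeval s P) - f * cp 𝒜 ((n : ℤ) - δ) t := by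
        have h3 : cp 𝒜 n r = r := by rw [cp_of_mem 𝒜 hr, if_pos rfl]
        rw [← cp_mul_left 𝒜 hfδ, add_sub_cancel, ← map_sub, ← hrt, h3]
      rw [h2]
      have hsm : s ∈ Algebra.adjoin k {f, s} := Algebra.subset_adjoin (by simp)
      have hfm : f ∈ Algebra.adjoin k {f, s} := Algebra.subset_adjoin (by simp)
      refine sub_mem ?_ (mul_mem hfm ?_)
      · clear hP hP' ht hrt h2
        induction P using Polynomial.induction_on' with
        | add P Q hP hQ => rw [map_add, map_add]; exact add_mem hP hQ
        | monomial i c =>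
          rw [Polynomial.aeval_monomial, ← Algebra.smul_def, map_smul]
          refine Subalgebra.smul_mem _ ?_ _
          rw [cp_of_mem 𝒜 (SetLike.pow_mem_graded i hs)]
          split_ifs
          · exact pow_mem hsm _
          · exact zero_mem _
      · by_cases hz : cp 𝒜 ((n : ℤ) - δ) t = 0
        · rw [hz]; exact zero_mem _
        · obtain ⟨m, hm, hmem⟩ := cp_mem_or 𝒜 _ _ hz
          exact ih m (by omega) _ hmem
  have htop2 : Algebra.adjoin k {f, s} = ⊤ := by
    rw [eq_top_iff]
    rintro b -
    induction b using DirectSum.Decomposition.inductionOn 𝒜 with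
    | zero => exact zero_mem _
    | @homogeneous n b => exact key n b b.2
    | add x y hx hy => exact add_mem hx hy
  have hsurj : Function.Surjective (aeval ![f, s] : MvPolynomial (Fin 2) k →ₐ[k] R) := by
    rw [← AlgHom.range_eq_top, ← Algebra.adjoin_range_eq_range_aeval, ← htop2]
    congr 1
    ext x
    simp [eq_comm, or_comm]
  have h1 := ringKrullDim_le_of_surjective (aeval ![f, s] : MvPolynomial (Fin 2) k →ₐ[k] R).toRingHom
    hsurj
  rw [hdim, MvPolynomial.ringKrullDim_of_isNoetherianRing] at h1
  simp at h1
  norm_num at h1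

end lifting

/-- Proposition 2.17 (CriterionKernel): let `R` be a 3-dimensional affine `k`-domain and
`f` a prime element of `R`. Then (a) ⇒ (b) ⇒ (c), where:
(a) some nonzero locally nilpotent derivation of `R` kills `f`;
(b) `R/fR` is not rigid;
(c) for each `ℕ`-grading of `R` with `f` homogeneous and `R₀ = k`, the projective curve
`Proj (R/fR)` is a unicuspidal rational curve (it contains an open subset isomorphic to
`𝔸¹_k`); here the grading on `R/fR` is the one induced by the grading of `R`. -/
theorem statement_11 (k : Type) [Field k] [IsAlgClosed k] [CharZero k]
    (R : Type) [CommRing R] [IsDomain R] [Algebra k R]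
    (haff : Algebra.FiniteType k R) (hdim : ringKrullDim R = 3)
    (f : R) (hf : Prime f) :
    ((∃ δ : Derivation k R R, IsLND δ ∧ δ ≠ 0 ∧ δ f = 0) →
        ¬ IsRigid k (R ⧸ Ideal.span {f})) ∧
    (¬ IsRigid k (R ⧸ Ideal.span {f}) →
      ∀ (𝒜 : ℕ → Submodule k R), GradedAlgebra 𝒜 →
        (∃ d : ℕ, f ∈ 𝒜 d) → 𝒜 0 = Submodule.span k {(1 : R)} →
        ∃ (ℬ : ℕ → Submodule k (R ⧸ Ideal.span {f})) (instB : GradedAlgebra ℬ),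
          (∀ (i : ℕ), ∀ r ∈ 𝒜 i, Ideal.Quotient.mk (Ideal.span {f}) r ∈ ℬ i) ∧
          @ProjContainsAffineLine k _ _ _ _ ℬ instB) := by
  have hnoeth : IsNoetherianRing R := Algebra.FiniteType.isNoetherianRing k R
  constructor
  · rintro ⟨δ, hδ, h0, hδf⟩
    exact aux_a_to_b k R f hf δ hδ h0 hδf
  · intro hrig 𝒜 inst ⟨d, hfd⟩ h0
    have hprime : (Ideal.span {f}).IsPrime := (Ideal.span_singleton_prime hf.ne_zero).mpr hf
    have hdom : IsDomain (R ⧸ Ideal.span {f}) := Ideal.Quotient.isDomain _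
    obtain ⟨instB⟩ := aux_quot_graded k R 𝒜 f d hfd
    refine ⟨_, instB, fun i r hr => ⟨r, hr, rfl⟩, ?_⟩
    have hft : Algebra.FiniteType k (R ⧸ Ideal.span {f}) :=
      Algebra.FiniteType.of_surjective (Ideal.Quotient.mkₐ k (Ideal.span {f}))
        (Ideal.Quotient.mkₐ_surjective k _)
    refine aux_b_to_c _ ?_ ?_ (not_adjoin_one k R hdim f hf 𝒜 d hfd h0) hrig
    · change Submodule.map _ (𝒜 0) = _
      rw [h0, Submodule.map_span, Set.image_singleton]
      simp
    · have h1 := ringKrullDim_quotient_succ_le_of_nonZeroDivisor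
        (mem_nonZeroDivisors_of_ne_zero hf.ne_zero)
      rw [hdim] at h1
      refine aux_trdeg_le k _ 2 ?_
      have h2 : ringKrullDim (R ⧸ Ideal.span {f}) + 1 ≤ (2 : WithBot ℕ∞) + 1 := by
        refine h1.trans (le_of_eq ?_); norm_num
      exact (ENat.WithBot.add_le_add_natCast_right_iff (c := 1)).mp (by exact_mod_cast h2)
end
end
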